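/- arXiv:0811.3552 — 3 statements merged into one kernel-verified Lean document; each statement's English description precedes it below -/
import Mathlib

section
/- Suppose F is in the Gumbel max-domain of attraction with positive scaling function w, and that lim_{u→∞} w(α_ρ u)/w(u) = ∞, where α_ρ := √(2/(1+ρ)) > 1. Then lim_{u→∞} S_u(x,y) = ∞ whenever x > 1 and y > 1, and lim_{u→∞} S_u(x,y) = 0 whenever x ∈ (0,1) and y ∈ (0,1). -/
open MeasureTheory ProbabilityTheory Filter Real

/-- The uniform distribution on the unit circle of `ℝ²`, obtained as the pushforward of the
normalized Lebesgue measure on `(0, 2π]` under the parametrization `θ ↦ (cos θ, sin θ)`. -/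
noncomputable def uniformCircle : Measure (ℝ × ℝ) :=
  Measure.map (fun θ : ℝ => (Real.cos θ, Real.sin θ))
    ((ENNReal.ofReal (2 * Real.pi))⁻¹ • volume.restrict (Set.Ioc 0 (2 * Real.pi)))

theorem uniformCircle_apply {A : Set (ℝ × ℝ)} (hA : MeasurableSet A) :
    uniformCircle A = (ENNReal.ofReal (2 * π))⁻¹ *
      volume ({θ : ℝ | (cos θ, sin θ) ∈ A} ∩ Set.Ioc 0 (2 * π)) := by
  have hm : Measurable fun θ : ℝ => (cos θ, sin θ) := by fun_prop
  rw [uniformCircle, Measure.map_apply hm hA, Measure.smul_apply,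
    Measure.restrict_apply (hm hA), smul_eq_mul]
  rfl

theorem uniformCircle_le {A : Set (ℝ × ℝ)} (hA : MeasurableSet A) {L : ℝ}
    (h : volume ({θ : ℝ | (cos θ, sin θ) ∈ A} ∩ Set.Ioc 0 (2 * π)) ≤
      ENNReal.ofReal (2 * π * L)) :
    uniformCircle A ≤ ENNReal.ofReal L := by
  rw [uniformCircle_apply hA]
  have hpi : (0 : ℝ) < 2 * π := by positivity
  rw [ENNReal.inv_mul_le_iff (by simpa using hpi) ENNReal.ofReal_ne_top,
    ← ENNReal.ofReal_mul hpi.le]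
  exact h

theorem le_uniformCircle {A : Set (ℝ × ℝ)} (hA : MeasurableSet A) {L : ℝ}
    (h : ENNReal.ofReal (2 * π * L) ≤
      volume ({θ : ℝ | (cos θ, sin θ) ∈ A} ∩ Set.Ioc 0 (2 * π))) :
    ENNReal.ofReal L ≤ uniformCircle A := by
  rw [uniformCircle_apply hA]
  have hpi : (0 : ℝ) < 2 * π := by positivity
  rw [mul_comm, ← div_eq_mul_inv, ENNReal.le_div_iff_mul_le (Or.inl (by simpa using hpi))
    (Or.inl ENNReal.ofReal_ne_top), mul_comm, ← ENNReal.ofReal_mul hpi.le]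
  exact h

theorem sub_le_pi_mul_sqrt_of_cos_sub_cos_le {A B d : ℝ} (hA : 0 ≤ A) (hAB : A ≤ B)
    (hB : B ≤ π) (h : cos A - cos B ≤ d) : B - A ≤ π * √d := by
  have h1 : cos A - cos B = 2 * sin ((A + B) / 2) * sin ((B - A) / 2) := by
    rw [Real.cos_sub_cos, show (B - A) / 2 = -((A - B) / 2) by ring, Real.sin_neg]; ring
  have h2 : sin ((B - A) / 2) ≤ sin ((A + B) / 2) := by
    rcases le_total ((A + B) / 2) (π / 2) with h | h
    · exact Real.sin_le_sin_of_le_of_le_pi_div_two (by linarith) h (by linarith)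
    · rw [← Real.sin_pi_sub ((A + B) / 2)]
      exact Real.sin_le_sin_of_le_of_le_pi_div_two (by linarith) (by linarith) (by linarith)
  have h3 : 2 / π * ((B - A) / 2) ≤ sin ((B - A) / 2) :=
    Real.mul_le_sin (by linarith) (by linarith)
  have hpi := Real.pi_pos
  have h4 : 2 / π * ((B - A) / 2) = (B - A) / π := by field_simp
  have h5 : 0 ≤ (B - A) / π := div_nonneg (by linarith) hpi.le
  rw [h4] at h3
  have h6 : ((B - A) / π) ^ 2 ≤ d := by nlinarith
  have h7 := Real.le_sqrt_of_sq_le h6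
  rw [div_le_iff₀ hpi] at h7
  linarith

theorem volume_cos_mem_Ioc_le (z₁ z₂ : ℝ) :
    volume ({θ : ℝ | z₁ < cos θ ∧ cos θ ≤ z₂} ∩ Set.Icc 0 π) ≤
      ENNReal.ofReal (π * √(z₂ - z₁)) := by
  refine (Real.volume_le_diam _).trans (Metric.ediam_le ?_)
  have key : ∀ θ θ' : ℝ, θ ∈ {θ : ℝ | z₁ < cos θ ∧ cos θ ≤ z₂} ∩ Set.Icc 0 π →
      θ' ∈ {θ : ℝ | z₁ < cos θ ∧ cos θ ≤ z₂} ∩ Set.Icc 0 π → θ ≤ θ' →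
      |θ - θ'| ≤ π * √(z₂ - z₁) := by
    rintro θ θ' ⟨⟨h1, h2⟩, h3, h4⟩ ⟨⟨h1', h2'⟩, h3', h4'⟩ hle
    rw [abs_of_nonpos (by linarith), neg_sub]
    exact sub_le_pi_mul_sqrt_of_cos_sub_cos_le h3 hle h4' (by linarith)
  intro θ hθ θ' hθ'
  rw [edist_dist, Real.dist_eq]
  apply ENNReal.ofReal_le_ofReal
  rcases le_total θ θ' with h | h
  · exact key θ θ' hθ hθ' h
  · rw [abs_sub_comm]; exact key θ' θ hθ' hθ h

theorem uniformCircle_fst_mem_Ioc_le (z₁ z₂ : ℝ) :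
    uniformCircle {p | z₁ < p.1 ∧ p.1 ≤ z₂} ≤ ENNReal.ofReal √(z₂ - z₁) := by
  apply uniformCircle_le
  · exact (measurableSet_lt measurable_const measurable_fst).inter
      (measurableSet_le measurable_fst measurable_const)
  set S := {θ : ℝ | z₁ < cos θ ∧ cos θ ≤ z₂} ∩ Set.Icc 0 π with hS
  have hsub : {θ : ℝ | (cos θ, sin θ) ∈ {p : ℝ × ℝ | z₁ < p.1 ∧ p.1 ≤ z₂}} ∩
      Set.Ioc 0 (2 * π) ⊆ S ∪ (fun θ => 2 * π - θ) ⁻¹' S := by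
    rintro θ ⟨⟨h1, h2⟩, h3, h4⟩
    simp only at h1 h2
    rcases le_total θ π with h | h
    · exact Or.inl ⟨⟨h1, h2⟩, h3.le, h⟩
    · refine Or.inr ⟨⟨?_, ?_⟩, ?_, ?_⟩ <;> simp only [Real.cos_two_pi_sub] <;> linarith
  have hmp : volume ((fun θ : ℝ => 2 * π - θ) ⁻¹' S) = volume S := by
    have hSm : MeasurableSet S := by
      refine MeasurableSet.inter ?_ measurableSet_Icc
      exact (measurableSet_lt measurable_const Real.measurable_cos).inter
        (measurableSet_le Real.measurable_cos measurable_const)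
    exact (Measure.measurePreserving_sub_left volume (2 * π)).measure_preimage
      hSm.nullMeasurableSet
  calc _ ≤ volume S + volume ((fun θ : ℝ => 2 * π - θ) ⁻¹' S) :=
        (measure_mono hsub).trans (measure_union_le _ _)
    _ ≤ ENNReal.ofReal (π * √(z₂ - z₁)) + ENNReal.ofReal (π * √(z₂ - z₁)) := by
        rw [hmp]; exact add_le_add (volume_cos_mem_Ioc_le _ _) (volume_cos_mem_Ioc_le _ _)
    _ = _ := by
        rw [← ENNReal.ofReal_add (by positivity) (by positivity)]; congr 1; ring

theorem le_uniformCircle_lt_fst {z : ℝ} (hz : 0 ≤ z) (hz1 : z ≤ 1) :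
    ENNReal.ofReal (√(1 - z) / (2 * π)) ≤ uniformCircle {p | z < p.1} := by
  apply le_uniformCircle (measurableSet_lt measurable_const measurable_fst)
  have hpi := Real.pi_gt_three
  rw [show 2 * π * (√(1 - z) / (2 * π)) = √(1 - z) - 0 by field_simp; ring, ← Real.volume_Ioo]
  apply measure_mono
  rintro θ ⟨h1, h2⟩
  have h3 : √(1 - z) ^ 2 = 1 - z := Real.sq_sqrt (by linarith)
  have h4 := Real.one_sub_sq_div_two_le_cos (x := θ)
  have h5 : √(1 - z) ≤ 1 := Real.sqrt_le_one.mpr (by linarith)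
  refine ⟨?_, h1, by linarith⟩
  change z < cos θ
  nlinarith

theorem exists_half_angle {ρ : ℝ} (hρ : ρ ∈ Set.Ioo (-1 : ℝ) 1) :
    ∃ h ∈ Set.Ioo 0 (π / 2), √((1 + ρ) / 2) = cos h ∧ 0 < cos h ∧ 0 < sin h ∧
      ∀ θ, ρ * cos θ + √(1 - ρ ^ 2) * sin θ = cos (θ - h - h) := by
  have h0 : 0 < arccos ρ := Real.arccos_pos.mpr hρ.2
  have hpi : arccos ρ < π := by
    refine lt_of_le_of_ne (Real.arccos_le_pi _) fun h => ?_
    have := Real.arccos_eq_pi.mp h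
    linarith [hρ.1]
  have hc : cos (arccos ρ) = ρ := Real.cos_arccos hρ.1.le hρ.2.le
  refine ⟨arccos ρ / 2, ⟨by linarith, by linarith⟩, ?_, ?_, ?_, fun θ => ?_⟩
  · rw [Real.cos_half (by linarith) hpi.le, hc]
  · exact Real.cos_pos_of_mem_Ioo ⟨by linarith, by linarith⟩
  · exact Real.sin_pos_of_pos_of_lt_pi (by linarith) (by linarith)
  · rw [show θ - arccos ρ / 2 - arccos ρ / 2 = θ - arccos ρ by ring, Real.cos_sub, hc,
      Real.sin_arccos]
    ring

theorem measurableSet_joint_le (ρ z : ℝ) : MeasurableSet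
    {p : ℝ × ℝ | z ≤ p.1 ∧ z ≤ ρ * p.1 + √(1 - ρ ^ 2) * p.2} :=
  (measurableSet_le measurable_const measurable_fst).inter
    (measurableSet_le measurable_const
      ((measurable_fst.const_mul ρ).add (measurable_snd.const_mul _)))

theorem measurableSet_joint_lt (ρ z : ℝ) : MeasurableSet
    {p : ℝ × ℝ | z < p.1 ∧ z < ρ * p.1 + √(1 - ρ ^ 2) * p.2} :=
  (measurableSet_lt measurable_const measurable_fst).inter
    (measurableSet_lt measurable_const
      ((measurable_fst.const_mul ρ).add (measurable_snd.const_mul _)))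

theorem exists_uniformCircle_joint_le {ρ : ℝ} (hρ : ρ ∈ Set.Ioo (-1 : ℝ) 1) :
    ∃ C > 0, ∀ z : ℝ, 0 ≤ z → uniformCircle {p | z * √((1 + ρ) / 2) ≤ p.1 ∧
      z * √((1 + ρ) / 2) ≤ ρ * p.1 + √(1 - ρ ^ 2) * p.2} ≤ ENNReal.ofReal (C * (1 - z)) := by
  obtain ⟨h, ⟨h0, hpi2⟩, hb, hc, hs, hX⟩ := exists_half_angle hρ
  have hpi := Real.pi_pos
  refine ⟨cos h / sin h, by positivity, fun z hz => ?_⟩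
  apply uniformCircle_le (measurableSet_joint_le _ _)
  rw [hb]
  set L := π / 2 * (cos h / sin h * (1 - z)) with hL
  have near : ∀ ψ, -(π / 2) ≤ ψ → ψ ≤ π / 2 → |sin ψ| ≤ cos h / sin h * (1 - z) → |ψ| ≤ L := by
    intro ψ h1 h2 h3
    have := Real.mul_abs_le_abs_sin (abs_le.mpr ⟨h1, h2⟩)
    have h4 : 2 / π * |ψ| ≤ cos h / sin h * (1 - z) := this.trans h3
    rw [hL]
    calc |ψ| = π / 2 * (2 / π * |ψ|) := by field_simp
      _ ≤ _ := by gcongr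
  have hsub : {θ : ℝ | (cos θ, sin θ) ∈ {p : ℝ × ℝ | z * cos h ≤ p.1 ∧
      z * cos h ≤ ρ * p.1 + √(1 - ρ ^ 2) * p.2}} ∩ Set.Ioc 0 (2 * π) ⊆
      Set.Icc (h - L) (h + L) ∪ Set.Icc (h + 2 * π - L) (h + 2 * π + L) := by
    rintro θ ⟨⟨h1, h2⟩, h3, h4⟩
    simp only [hX] at h1 h2
    obtain ⟨ψ, rfl⟩ : ∃ ψ, θ = ψ + h := ⟨θ - h, by ring⟩
    rw [show ψ + h - h - h = ψ - h by ring, Real.cos_sub] at h2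
    rw [Real.cos_add] at h1
    have hsin : |sin ψ| * sin h ≤ (1 - z) * cos h := by
      have := Real.cos_le_one ψ
      rcases abs_cases (sin ψ) with ⟨h5, -⟩ | ⟨h5, -⟩ <;> rw [h5] <;> nlinarith
    have hcos : 0 ≤ cos ψ := by
      have : z * cos h ≤ cos ψ * cos h := by linarith
      exact hz.trans (le_of_mul_le_mul_right this hc)
    have hsin' : |sin ψ| ≤ cos h / sin h * (1 - z) := by
      rw [div_mul_eq_mul_div, le_div_iff₀ hs]; linarith
    rcases le_total ψ (π / 2) with h5 | h5
    · have := abs_le.mp (near ψ (by linarith) h5 hsin')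
      exact Or.inl ⟨by linarith, by linarith⟩
    · have h6 : 3 * π / 2 ≤ ψ := by
        by_contra! hcon
        rcases h5.lt_or_eq with h7 | h7
        · have := Real.cos_neg_of_pi_div_two_lt_of_lt h7 (by linarith)
          linarith
        · rw [← h7, Real.cos_pi_div_two] at h1 h2
          rw [Real.sin_pi_div_two] at h1
          nlinarith
      have := abs_le.mp (near (ψ - 2 * π) (by linarith) (by linarith)
        (by rwa [Real.sin_sub_two_pi]))
      exact Or.inr ⟨by linarith, by linarith⟩
  refine (measure_mono hsub).trans ((measure_union_le _ _).trans ?_)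
  rw [Real.volume_Icc, Real.volume_Icc, show h + L - (h - L) = 2 * L by ring,
    show h + 2 * π + L - (h + 2 * π - L) = 2 * L by ring]
  rcases le_total 0 L with h5 | h5
  · rw [← ENNReal.ofReal_add (by linarith) (by linarith)]
    apply ENNReal.ofReal_le_ofReal
    rw [hL]; apply le_of_eq; ring
  · rw [ENNReal.ofReal_of_nonpos (by linarith)]; simp

theorem exists_le_uniformCircle_joint {ρ : ℝ} (hρ : ρ ∈ Set.Ioo (-1 : ℝ) 1) :
    ∃ c > 0, ∀ z : ℝ, 0 ≤ z → z ≤ 1 → ENNReal.ofReal (c * (1 - z)) ≤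
      uniformCircle {p | z * √((1 + ρ) / 2) < p.1 ∧
        z * √((1 + ρ) / 2) < ρ * p.1 + √(1 - ρ ^ 2) * p.2} := by
  obtain ⟨h, ⟨h0, hpi2⟩, hb, hc, hs, hX⟩ := exists_half_angle hρ
  have hpi := Real.pi_gt_three
  set η := cos h / (cos h + sin h) with hη
  have hη0 : 0 < η := by positivity
  have hη1 : η ≤ 1 := by rw [hη, div_le_one (by positivity)]; linarith
  have hηe : η * (cos h + sin h) = cos h := by rw [hη]; field_simp
  refine ⟨η / (2 * π), by positivity, fun z hz hz1 => ?_⟩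
  apply le_uniformCircle (measurableSet_joint_lt _ _)
  rw [hb, show 2 * π * (η / (2 * π) * (1 - z)) = h + η * (1 - z) - h by field_simp; ring,
    ← Real.volume_Ioo]
  apply measure_mono
  rintro θ ⟨h1, h2⟩
  obtain ⟨ψ, rfl⟩ : ∃ ψ, θ = ψ + h := ⟨θ - h, by ring⟩
  have hψ0 : 0 < ψ := by linarith
  have hψ : ψ < η * (1 - z) := by linarith
  have hψ1 : ψ ≤ 1 := by nlinarith
  have hcos := Real.one_sub_sq_div_two_le_cos (x := ψ)
  have hsin := Real.sin_le hψ0.le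
  have hsin0 : 0 ≤ sin ψ := Real.sin_nonneg_of_nonneg_of_le_pi hψ0.le (by linarith)
  have hkey : z * cos h < cos ψ * cos h - sin ψ * sin h := by
    have e1 : ψ * (cos h + sin h) < (1 - z) * cos h := by
      calc ψ * (cos h + sin h) < η * (1 - z) * (cos h + sin h) := by gcongr
        _ = (1 - z) * cos h := by linear_combination (1 - z) * hηe
    have e2 : (1 - ψ) * cos h ≤ cos ψ * cos h := by
      gcongr; nlinarith
    have e3 : sin ψ * sin h ≤ ψ * sin h := by gcongr
    nlinarith
  refine ⟨⟨?_, ?_⟩, by linarith, by nlinarith⟩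
  · simp only [Real.cos_add]; exact hkey
  · simp only [hX]
    rw [show ψ + h - h - h = ψ - h by ring, Real.cos_sub]
    have : 0 ≤ sin ψ * sin h := by positivity
    linarith

/-- `G` is the survival function of a positive, unbounded random variable in the Gumbel
max-domain of attraction with auxiliary function `a`. -/
structure IsGumbelTail (G a : ℝ → ℝ) : Prop where
  antitone : Antitone G
  pos : ∀ x, 0 < G x
  eq_one : ∀ x ≤ 0, G x = 1
  tendsto_zero : Tendsto G atTop (nhds 0)
  scale_pos : ∀ x, 0 < a x
  tendsto_ratio : ∀ x, Tendsto (fun u => G (u + x * a u) / G u) atTop (nhds (exp (-x)))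

namespace IsGumbelTail

variable {G a : ℝ → ℝ}

theorem eventually_le (h : IsGumbelTail G a) {x b : ℝ} (hb : exp (-x) < b) :
    ∀ᶠ u in atTop, G (u + x * a u) ≤ b * G u := by
  filter_upwards [(h.tendsto_ratio x).eventually_le_const hb] with u hu
  rwa [div_le_iff₀ (h.pos u)] at hu

theorem eventually_ge (h : IsGumbelTail G a) {x b : ℝ} (hb : b < exp (-x)) :
    ∀ᶠ u in atTop, b * G u ≤ G (u + x * a u) := by
  filter_upwards [(h.tendsto_ratio x).eventually_const_le hb] with u hu
  rwa [le_div_iff₀ (h.pos u)] at hu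

theorem tendsto_add_mul_scale (h : IsGumbelTail G a) {k : ℝ} (hk : 0 ≤ k) :
    Tendsto (fun u => u + k * a u) atTop atTop :=
  tendsto_atTop_mono (fun u => by have := h.scale_pos u; simp only [id]; nlinarith) tendsto_id

theorem eventually_mul_scale_lt (h : IsGumbelTail G a) (K : ℝ) :
    ∀ᶠ u in atTop, K * a u < u := by
  have h1 := h.eventually_le (x := -K) (b := exp K + 1) (by simp)
  have h2 : ∀ᶠ u in atTop, G u < (exp K + 1)⁻¹ :=
    h.tendsto_zero.eventually_lt_const (by positivity)
  filter_upwards [h1, h2] with u hu1 hu2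
  by_contra! hcon
  rw [h.eq_one _ (by linarith)] at hu1
  have hpos : 0 < exp K + 1 := by positivity
  have : (exp K + 1) * G u < (exp K + 1) * (exp K + 1)⁻¹ := by gcongr
  rw [mul_inv_cancel₀ hpos.ne'] at this
  linarith

theorem eventually_scale_le (h : IsGumbelTail G a) {k l : ℝ} (hk : 0 ≤ k) (hl : 1 < l) :
    ∀ᶠ u in atTop, a (u + k * a u) ≤ l * a u := by
  have h1 := h.tendsto_ratio k
  have h2 := (h.tendsto_ratio 1).comp (h.tendsto_add_mul_scale hk)
  have h3 := h2.mul h1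
  have h4 := h.tendsto_ratio (k + l)
  have hlt : exp (-(k + l)) < exp (-1) * exp (-k) := by
    rw [← Real.exp_add]; exact Real.exp_lt_exp.mpr (by linarith)
  filter_upwards [h4.eventually_lt h3 hlt] with u hu
  by_contra! hcon
  simp only [Function.comp_apply] at hu
  rw [div_mul_div_cancel₀ (h.pos _).ne', div_lt_div_iff_of_pos_right (h.pos u)] at hu
  exact absurd (h.antitone (show u + (k + l) * a u ≤ u + k * a u + 1 * a (u + k * a u) by
    linarith)) (not_le.mpr hu)

theorem lintegral_sub_le_tsum (ν : Measure ℝ) {σ α : ℕ → ℝ} (hσ : ∀ n, σ (n + 1) = σ n + α n)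
    (hα : ∀ n, 0 ≤ α n) (hub : ∀ r, ∃ n, r ≤ σ n) :
    ∫⁻ r, ENNReal.ofReal (r - σ 0) ∂ν ≤ ∑' n, ENNReal.ofReal (α n) * ν (Set.Ioi (σ n)) := by
  have key : ∀ r, ENNReal.ofReal (r - σ 0) ≤
      ∑' n, (Set.Ioi (σ n)).indicator (fun _ => ENNReal.ofReal (α n)) r := by
    intro r
    have step : ∀ N, ENNReal.ofReal (min r (σ N) - σ 0) ≤
        ∑ n ∈ Finset.range N, (Set.Ioi (σ n)).indicator (fun _ => ENNReal.ofReal (α n)) r := by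
      intro N
      induction N with
      | zero => simp
      | succ N ih =>
        rw [Finset.sum_range_succ]
        by_cases hr : σ N < r
        · rw [Set.indicator_of_mem (by exact hr)]
          refine le_trans ?_ (add_le_add_left ih _)
          refine le_trans (ENNReal.ofReal_le_ofReal ?_) ENNReal.ofReal_add_le
          rw [min_eq_right hr.le]
          have := min_le_right r (σ (N + 1))
          rw [hσ] at this ⊢
          linarith
        · rw [Set.indicator_of_notMem (by exact hr), add_zero]
          push Not at hr
          rw [min_eq_left (by rw [hσ]; linarith [hα N])]
          rwa [min_eq_left hr] at ih
    obtain ⟨N, hN⟩ := hub r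
    have := step N
    rw [min_eq_left hN] at this
    exact this.trans (ENNReal.sum_le_tsum _)
  calc ∫⁻ r, ENNReal.ofReal (r - σ 0) ∂ν
      ≤ ∫⁻ r, ∑' n, (Set.Ioi (σ n)).indicator (fun _ => ENNReal.ofReal (α n)) r ∂ν :=
        lintegral_mono key
    _ = ∑' n, ∫⁻ r, (Set.Ioi (σ n)).indicator (fun _ => ENNReal.ofReal (α n)) r ∂ν :=
        lintegral_tsum fun n => (measurable_const.indicator measurableSet_Ioi).aemeasurable
    _ = _ := by
        congr 1; ext n; rw [lintegral_indicator_const measurableSet_Ioi]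

theorem eventually_lintegral_sub_le (h : IsGumbelTail G a) (ν : Measure ℝ)
    (hν : ∀ t, ν (Set.Ioi t) = ENNReal.ofReal (G t)) :
    ∀ᶠ s in atTop, ∫⁻ r, ENNReal.ofReal (r - s) ∂ν ≤ ENNReal.ofReal (8 / 3 * (a s * G s)) := by
  have he : exp (-1) < 1 / 2 := by
    have := Real.exp_neg_one_lt_d9; linarith
  obtain ⟨s₀, hs₀⟩ := eventually_atTop.mp
    ((h.eventually_le he).and (h.eventually_scale_le zero_le_one (show (1 : ℝ) < 5 / 4 by norm_num)))
  filter_upwards [eventually_ge_atTop s₀] with s hs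
  set σ : ℕ → ℝ := fun n => (fun u => u + 1 * a u)^[n] s with hσ
  have hσs : ∀ n, σ (n + 1) = σ n + 1 * a (σ n) := fun n => by
    simp only [hσ, Function.iterate_succ_apply']
  have hσ0 : σ 0 = s := rfl
  have hge : ∀ n, s₀ ≤ σ n := by
    intro n
    induction n with
    | zero => exact hs
    | succ n ih => rw [hσs]; linarith [h.scale_pos (σ n)]
  have hG : ∀ n, G (σ n) ≤ (1 / 2) ^ n * G s := by
    intro n
    induction n with
    | zero => simp [hσ0]
    | succ n ih => rw [hσs]; have := (hs₀ _ (hge n)).1; rw [pow_succ]; linarith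
  have ha : ∀ n, a (σ n) ≤ (5 / 4) ^ n * a s := by
    intro n
    induction n with
    | zero => simp [hσ0]
    | succ n ih => rw [hσs]; have := (hs₀ _ (hge n)).2; rw [pow_succ]; linarith
  have hub : ∀ r, ∃ n, r ≤ σ n := by
    intro r
    have hlim : Tendsto (fun n : ℕ => (1 / 2 : ℝ) ^ n * G s) atTop (nhds (0 * G s)) :=
      (tendsto_pow_atTop_nhds_zero_of_lt_one (by norm_num) (by norm_num)).mul_const _
    rw [zero_mul] at hlim
    obtain ⟨n, hn⟩ := (hlim.eventually_lt_const (h.pos r)).exists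
    refine ⟨n, le_of_lt ?_⟩
    by_contra! hcon
    linarith [h.antitone hcon, hG n]
  have h1 := lintegral_sub_le_tsum ν (σ := σ) (α := fun n => a (σ n))
    (fun n => by rw [hσs, one_mul]) (fun n => (h.scale_pos _).le) hub
  refine h1.trans ?_
  have has := (h.scale_pos s).le
  have hGs := (h.pos s).le
  have hsum : HasSum (fun n : ℕ => (5 / 8 : ℝ) ^ n * (a s * G s)) (8 / 3 * (a s * G s)) := by
    have := (hasSum_geometric_of_lt_one (r := (5 / 8 : ℝ)) (by norm_num) (by norm_num)).mul_right
      (a s * G s)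
    norm_num at this ⊢
    exact this
  rw [← hsum.tsum_eq, ENNReal.ofReal_tsum_of_nonneg (fun n => by positivity) hsum.summable]
  refine ENNReal.tsum_le_tsum fun n => ?_
  rw [hν, ← ENNReal.ofReal_mul (h.scale_pos _).le]
  apply ENNReal.ofReal_le_ofReal
  calc a (σ n) * G (σ n) ≤ ((5 / 4) ^ n * a s) * ((1 / 2) ^ n * G s) :=
        mul_le_mul (ha n) (hG n) (h.pos _).le (by positivity)
    _ = ((5 / 4) * (1 / 2)) ^ n * (a s * G s) := by rw [mul_pow]; ring
    _ = _ := by norm_num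

end IsGumbelTail

instance isProbabilityMeasure_uniformCircle : IsProbabilityMeasure uniformCircle := by
  refine ⟨?_⟩
  have hpi : (0 : ℝ) < 2 * π := by positivity
  rw [uniformCircle_apply MeasurableSet.univ]
  simp only [Set.mem_univ, Set.ofPred_true, Set.univ_inter, Real.volume_Ioc, sub_zero]
  exact ENNReal.inv_mul_cancel (by simpa using hpi) ENNReal.ofReal_ne_top

theorem uniformCircle_one_lt_fst : uniformCircle {p | 1 < p.1} = 0 := by
  refine le_antisymm ((uniformCircle_le (L := 0)
    (measurableSet_lt measurable_const measurable_fst) ?_).trans (by simp)) zero_le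
  have : {θ : ℝ | (cos θ, sin θ) ∈ {p : ℝ × ℝ | 1 < p.1}} = ∅ := by
    ext θ
    simpa using Real.cos_le_one θ
  rw [this]; simp

theorem measurableSet_radial_lt (t : ℝ) :
    MeasurableSet {q : ℝ × ℝ × ℝ | t < q.1 * q.2.1} :=
  measurableSet_lt measurable_const (measurable_fst.mul (measurable_fst.comp measurable_snd))

/-- The event that both coordinates of the elliptical vector exceed `t`. -/
def jointExceed (ρ t : ℝ) : Set (ℝ × ℝ × ℝ) :=
  {q | t < q.1 * q.2.1 ∧ t < q.1 * (ρ * q.2.1 + √(1 - ρ ^ 2) * q.2.2)}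

/-- The event that both coordinates of the elliptical vector are at least `t`. -/
def jointAtLeast (ρ t : ℝ) : Set (ℝ × ℝ × ℝ) :=
  {q | t ≤ q.1 * q.2.1 ∧ t ≤ q.1 * (ρ * q.2.1 + √(1 - ρ ^ 2) * q.2.2)}

theorem measurable_radial_snd (ρ : ℝ) : Measurable fun q : ℝ × ℝ × ℝ =>
    q.1 * (ρ * q.2.1 + √(1 - ρ ^ 2) * q.2.2) :=
  measurable_fst.mul (((measurable_fst.comp measurable_snd).const_mul ρ).add
    ((measurable_snd.comp measurable_snd).const_mul _))

theorem measurableSet_jointAtLeast (ρ t : ℝ) : MeasurableSet (jointAtLeast ρ t) :=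
  (measurableSet_le measurable_const
    (measurable_fst.mul (measurable_fst.comp measurable_snd))).inter
    (measurableSet_le measurable_const (measurable_radial_snd ρ))

section Radial

variable (ν : Measure ℝ)

theorem le_prod_radial {t r : ℝ} (ht : 0 < t) (hr : t < r) :
    ν (Set.Ioi r) * ENNReal.ofReal (√(1 - t / r) / (2 * π)) ≤
      ν.prod uniformCircle {q | t < q.1 * q.2.1} := by
  have hr0 : 0 < r := ht.trans hr
  calc _ ≤ ν (Set.Ioi r) * uniformCircle {p | t / r < p.1} := by
        gcongr
        exact le_uniformCircle_lt_fst (by positivity) ((div_le_one hr0).mpr hr.le)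
    _ = ν.prod uniformCircle (Set.Ioi r ×ˢ {p | t / r < p.1}) := (Measure.prod_prod _ _).symm
    _ ≤ _ := by
        apply measure_mono
        rintro ⟨x, p⟩ ⟨h1, h2⟩
        simp only [Set.mem_Ioi, Set.mem_ofPred_eq] at h1 h2 ⊢
        rw [div_lt_iff₀ hr0] at h2
        have : 0 < p.1 := by
          by_contra! hcon
          nlinarith
        nlinarith

theorem prod_radial_Ioc_le (hν : ν (Set.Iic 0) = 0) {t₁ t₂ : ℝ} (h₁ : 0 < t₁) (h₂ : t₁ ≤ t₂) :
    ν.prod uniformCircle {q | t₁ < q.1 * q.2.1 ∧ q.1 * q.2.1 ≤ t₂} ≤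
      ENNReal.ofReal √((t₂ - t₁) / t₁) * ν (Set.Ioi t₁) := by
  have hm : MeasurableSet {q : ℝ × ℝ × ℝ | t₁ < q.1 * q.2.1 ∧ q.1 * q.2.1 ≤ t₂} :=
    (measurableSet_radial_lt t₁).inter (measurableSet_le
      (measurable_fst.mul (measurable_fst.comp measurable_snd)) measurable_const)
  rw [Measure.prod_apply hm, ← lintegral_indicator_const measurableSet_Ioi]
  have hpos : ∀ᵐ r ∂ν, 0 < r := by
    rw [ae_iff]; simpa [Set.Iic] using hν
  refine lintegral_mono_ae (hpos.mono fun r hr => ?_)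
  by_cases hrt : t₁ < r
  · rw [Set.indicator_of_mem (by exact hrt)]
    calc _ ≤ uniformCircle {p | t₁ / r < p.1 ∧ p.1 ≤ t₂ / r} := by
          apply measure_mono
          rintro p ⟨h1, h2⟩
          simp only at h1 h2
          exact ⟨by rw [div_lt_iff₀ hr]; linarith, by rw [le_div_iff₀ hr]; linarith⟩
      _ ≤ ENNReal.ofReal √(t₂ / r - t₁ / r) := uniformCircle_fst_mem_Ioc_le _ _
      _ ≤ _ := by
          rw [← sub_div]
          apply ENNReal.ofReal_le_ofReal
          apply Real.sqrt_le_sqrt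
          exact div_le_div_of_nonneg_left (by linarith) h₁ hrt.le
  · rw [Set.indicator_of_notMem (by exact hrt)]
    push Not at hrt
    refine (measure_mono ?_).trans uniformCircle_one_lt_fst.le
    rintro p ⟨h1, h2⟩
    simp only [Set.mem_ofPred_eq] at h1 ⊢
    by_contra! hcon
    nlinarith

theorem exists_le_prod_jointExceed {ρ : ℝ} (hρ : ρ ∈ Set.Ioo (-1 : ℝ) 1) :
    ∃ c > 0, ∀ s r : ℝ, 0 < s → s < r →
      ν (Set.Ioi r) * ENNReal.ofReal (c * (1 - s / r)) ≤
        ν.prod uniformCircle (jointExceed ρ (s * √((1 + ρ) / 2))) := by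
  obtain ⟨c, hc, h⟩ := exists_le_uniformCircle_joint hρ
  refine ⟨c, hc, fun s r hs hr => ?_⟩
  have hr0 : 0 < r := hs.trans hr
  have hb : 0 ≤ √((1 + ρ) / 2) := Real.sqrt_nonneg _
  set b := √((1 + ρ) / 2)
  calc _ ≤ ν (Set.Ioi r) * uniformCircle {p | s / r * b < p.1 ∧
            s / r * b < ρ * p.1 + √(1 - ρ ^ 2) * p.2} := by
        gcongr
        exact h _ (by positivity) ((div_le_one hr0).mpr hr.le)
    _ = ν.prod uniformCircle (Set.Ioi r ×ˢ {p | s / r * b < p.1 ∧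
            s / r * b < ρ * p.1 + √(1 - ρ ^ 2) * p.2}) := (Measure.prod_prod _ _).symm
    _ ≤ _ := by
        apply measure_mono
        have aux : ∀ x y, r < x → s / r * b < y → s * b < x * y := by
          intro x y hx hy
          have hy0 : 0 < y := lt_of_le_of_lt (by positivity) hy
          rw [div_mul_eq_mul_div, div_lt_iff₀ hr0] at hy
          nlinarith
        rintro ⟨x, p⟩ ⟨h1, h2, h3⟩
        exact ⟨aux _ _ h1 h2, aux _ _ h1 h3⟩

theorem exists_prod_jointAtLeast_le (hν : ν (Set.Iic 0) = 0)
    {ρ : ℝ} (hρ : ρ ∈ Set.Ioo (-1 : ℝ) 1) :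
    ∃ C > 0, ∀ s : ℝ, 0 < s →
      ν.prod uniformCircle (jointAtLeast ρ (s * √((1 + ρ) / 2))) ≤
        ENNReal.ofReal (C / s) * ∫⁻ r, ENNReal.ofReal (r - s) ∂ν := by
  obtain ⟨C, hC, h⟩ := exists_uniformCircle_joint_le hρ
  refine ⟨C, hC, fun s hs => ?_⟩
  set b := √((1 + ρ) / 2)
  rw [Measure.prod_apply (measurableSet_jointAtLeast _ _),
    ← lintegral_const_mul _ (by fun_prop)]
  have hpos : ∀ᵐ r ∂ν, 0 < r := by
    rw [ae_iff]; simpa [Set.Iic] using hν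
  refine lintegral_mono_ae (hpos.mono fun r hr => ?_)
  calc _ ≤ uniformCircle {p | s / r * b ≤ p.1 ∧
            s / r * b ≤ ρ * p.1 + √(1 - ρ ^ 2) * p.2} := by
        apply measure_mono
        have aux : ∀ y, s * b ≤ r * y → s / r * b ≤ y := by
          intro y hy
          rw [div_mul_eq_mul_div, div_le_iff₀ hr]; linarith
        rintro p ⟨h1, h2⟩
        exact ⟨aux _ h1, aux _ h2⟩
    _ ≤ ENNReal.ofReal (C * (1 - s / r)) := h _ (by positivity)
    _ ≤ ENNReal.ofReal (C / s) * ENNReal.ofReal (r - s) := by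
        rw [← ENNReal.ofReal_mul (by positivity)]
        rcases le_total s r with hsr | hsr
        · apply ENNReal.ofReal_le_ofReal
          rw [div_mul_eq_mul_div, mul_div_assoc]
          gcongr
          rw [one_sub_div hr.ne']
          exact div_le_div_of_nonneg_left (by linarith) hs hsr
        · rw [ENNReal.ofReal_of_nonpos]
          · exact zero_le
          · have : 1 ≤ s / r := (one_le_div hr).mpr hsr
            nlinarith

end Radial

namespace IsGumbelTail

variable {ν : Measure ℝ} {G a : ℝ → ℝ}

theorem measure_Iic_zero [IsProbabilityMeasure ν] (h : IsGumbelTail G a)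
    (hν : ∀ t, ν (Set.Ioi t) = ENNReal.ofReal (G t)) : ν (Set.Iic 0) = 0 := by
  rw [← Set.compl_Ioi, prob_compl_eq_zero_iff measurableSet_Ioi, hν, h.eq_one 0 le_rfl,
    ENNReal.ofReal_one]

variable [IsProbabilityMeasure ν]

theorem exists_survival_sub_le (h : IsGumbelTail G a)
    (hν : ∀ t, ν (Set.Ioi t) = ENNReal.ofReal (G t)) {m : ℝ} (hm : 1 < m) :
    ∃ c > 0, ∀ᶠ t in atTop,
      (ν.prod uniformCircle).real {q | t - c * a t < q.1 * q.2.1} ≤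
        m * (ν.prod uniformCircle).real {q | t + c * a t < q.1 * q.2.1} := by
  have hpi := Real.pi_pos
  set δ := (m - 1) / (216 * π) with hδ
  have hδ0 : 0 < δ := by have : 0 < m - 1 := by linarith
                         positivity
  set c := min 1 (δ ^ 2) with hc
  have hc0 : 0 < c := by positivity
  have hc1 : c ≤ 1 := min_le_left _ _
  have hcδ : √c ≤ δ := Real.sqrt_le_iff.mpr ⟨hδ0.le, min_le_right _ _⟩
  refine ⟨c, hc0, ?_⟩
  have e1 : exp (-(-1)) < 3 := by
    rw [neg_neg]; exact Real.exp_one_lt_three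
  have e2 : 1 / 9 < exp (-2) := by
    rw [show (-2 : ℝ) = -1 + -1 by norm_num, Real.exp_add]
    have := Real.exp_neg_one_gt_d9
    nlinarith
  filter_upwards [h.eventually_le e1, h.eventually_ge e2, h.eventually_mul_scale_lt 4,
    eventually_gt_atTop 0] with t h1 h2 h3 ht
  have ha := h.scale_pos t
  have hG := h.pos t
  set A := a t
  have hcA : c * A ≤ A := by nlinarith
  have hcA0 : 0 < c * A := by positivity
  have hlow : √(A / t) / 2 * (G t / 9) / (2 * π) ≤
      (ν.prod uniformCircle).real {q | t + c * A < q.1 * q.2.1} := by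
    rw [measureReal_def, ← ENNReal.ofReal_le_iff_le_toReal (measure_ne_top _ _)]
    have h4 := le_prod_radial ν (t := t + A) (r := t + 2 * A) (by linarith) (by linarith)
    have hmono : ν.prod uniformCircle {q | t + A < q.1 * q.2.1} ≤
        ν.prod uniformCircle {q | t + c * A < q.1 * q.2.1} :=
      measure_mono fun q hq => lt_of_le_of_lt (show t + c * A ≤ t + A by linarith) hq
    refine le_trans ?_ (h4.trans hmono)
    rw [hν, ← ENNReal.ofReal_mul (h.pos _).le]
    apply ENNReal.ofReal_le_ofReal
    have h5 : √(A / t) / 2 ≤ √(1 - (t + A) / (t + 2 * A)) := by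
      apply Real.le_sqrt_of_sq_le
      rw [div_pow, Real.sq_sqrt (by positivity), one_sub_div (by positivity), div_div,
        show t + 2 * A - (t + A) = A by ring]
      exact div_le_div_of_nonneg_left ha.le (by positivity) (by linarith)
    have h6 : G t / 9 ≤ G (t + 2 * A) := by linarith
    calc √(A / t) / 2 * (G t / 9) / (2 * π) = G t / 9 * (√(A / t) / 2 / (2 * π)) := by ring
      _ ≤ _ := by
        have := h.pos (t + 2 * A)
        gcongr
  have hinc : (ν.prod uniformCircle).real {q | t - c * A < q.1 * q.2.1 ∧
      q.1 * q.2.1 ≤ t + c * A} ≤ 2 * √c * √(A / t) * (3 * G t) := by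
    rw [measureReal_def]
    apply ENNReal.toReal_le_of_le_ofReal (by positivity)
    refine (prod_radial_Ioc_le ν (h.measure_Iic_zero hν) (by linarith) (by linarith)).trans ?_
    rw [hν, ← ENNReal.ofReal_mul (Real.sqrt_nonneg _)]
    apply ENNReal.ofReal_le_ofReal
    have h4 : √((t + c * A - (t - c * A)) / (t - c * A)) ≤ 2 * √c * √(A / t) := by
      rw [Real.sqrt_le_left (by positivity), mul_pow, mul_pow, Real.sq_sqrt hc0.le,
        Real.sq_sqrt (by positivity), div_le_iff₀ (by linarith)]
      have h5 : t / 2 ≤ t - c * A := by linarith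
      calc t + c * A - (t - c * A) = 2 ^ 2 * c * (A / t) * (t / 2) := by field_simp; ring
        _ ≤ _ := by gcongr
    have h5 : G (t - c * A) ≤ 3 * G t :=
      (h.antitone (show t + -1 * A ≤ t - c * A by linarith)).trans h1
    exact mul_le_mul h4 h5 (h.pos _).le (by positivity)
  have hsplit : (ν.prod uniformCircle).real {q | t - c * A < q.1 * q.2.1} ≤
      (ν.prod uniformCircle).real {q | t - c * A < q.1 * q.2.1 ∧ q.1 * q.2.1 ≤ t + c * A} +
      (ν.prod uniformCircle).real {q | t + c * A < q.1 * q.2.1} := by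
    refine le_trans (measureReal_mono ?_) (measureReal_union_le _ _)
    intro q hq
    rcases le_or_gt (q.1 * q.2.1) (t + c * A) with h4 | h4
    · exact Or.inl ⟨hq, h4⟩
    · exact Or.inr h4
  set D := (ν.prod uniformCircle).real {q | t + c * A < q.1 * q.2.1}
  have hfin : 2 * √c * √(A / t) * (3 * G t) ≤ (m - 1) * D := by
    calc 2 * √c * √(A / t) * (3 * G t) ≤ 2 * δ * √(A / t) * (3 * G t) := by gcongr
      _ = (m - 1) * (√(A / t) / 2 * (G t / 9) / (2 * π)) := by rw [hδ]; field_simp; ring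
      _ ≤ _ := by
        apply mul_le_mul_of_nonneg_left hlow; linarith
  linarith

theorem exists_jointAtLeast_le (h : IsGumbelTail G a)
    (hν : ∀ t, ν (Set.Ioi t) = ENNReal.ofReal (G t)) {ρ : ℝ} (hρ : ρ ∈ Set.Ioo (-1 : ℝ) 1) :
    ∃ C > 0, ∀ᶠ s in atTop,
      (ν.prod uniformCircle).real (jointAtLeast ρ (s * √((1 + ρ) / 2))) ≤
        C * (a s * G s / s) := by
  obtain ⟨C, hC, hJ⟩ := exists_prod_jointAtLeast_le ν (h.measure_Iic_zero hν) hρ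
  refine ⟨C * (8 / 3), by positivity, ?_⟩
  filter_upwards [h.eventually_lintegral_sub_le ν hν, eventually_gt_atTop 0] with s h1 hs
  have ha := h.scale_pos s
  have hG := h.pos s
  rw [measureReal_def]
  apply ENNReal.toReal_le_of_le_ofReal (by positivity)
  calc _ ≤ _ := hJ s hs
    _ ≤ ENNReal.ofReal (C / s) * ENNReal.ofReal (8 / 3 * (a s * G s)) := by gcongr
    _ = _ := by rw [← ENNReal.ofReal_mul (by positivity)]; congr 1; ring

theorem exists_le_jointExceed (h : IsGumbelTail G a)
    (hν : ∀ t, ν (Set.Ioi t) = ENNReal.ofReal (G t)) {ρ : ℝ} (hρ : ρ ∈ Set.Ioo (-1 : ℝ) 1) :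
    ∃ c > 0, ∀ s x : ℝ, 0 < s → 0 < x → c * (x / (s + x)) * G (s + x) ≤
      (ν.prod uniformCircle).real (jointExceed ρ (s * √((1 + ρ) / 2))) := by
  obtain ⟨c, hc, hJ⟩ := exists_le_prod_jointExceed ν hρ
  refine ⟨c, hc, fun s x hs hx => ?_⟩
  rw [measureReal_def, ← ENNReal.ofReal_le_iff_le_toReal (measure_ne_top _ _)]
  refine le_trans (le_of_eq ?_) (hJ s (s + x) hs (by linarith))
  rw [hν, ← ENNReal.ofReal_mul (h.pos _).le, one_sub_div (by positivity), mul_comm]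
  congr 4; ring

theorem jointExceed_pos (h : IsGumbelTail G a)
    (hν : ∀ t, ν (Set.Ioi t) = ENNReal.ofReal (G t)) {ρ : ℝ} (hρ : ρ ∈ Set.Ioo (-1 : ℝ) 1)
    {s : ℝ} (hs : 0 < s) :
    0 < (ν.prod uniformCircle).real (jointExceed ρ (s * √((1 + ρ) / 2))) := by
  obtain ⟨c, hc, hJ⟩ := h.exists_le_jointExceed hν hρ
  refine lt_of_lt_of_le ?_ (hJ s 1 hs one_pos)
  have := h.pos (s + 1)
  positivity

theorem exists_mul_jointAtLeast_le (h : IsGumbelTail G a)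
    (hν : ∀ t, ν (Set.Ioi t) = ENNReal.ofReal (G t)) {ρ : ℝ} (hρ : ρ ∈ Set.Ioo (-1 : ℝ) 1)
    {M : ℝ} (hM : 0 ≤ M) :
    ∃ k, ∀ᶠ s in atTop,
      M * (ν.prod uniformCircle).real (jointAtLeast ρ (s * √((1 + ρ) / 2))) ≤
        (ν.prod uniformCircle).real (jointExceed ρ ((s - k * a s) * √((1 + ρ) / 2))) := by
  obtain ⟨C, hC, hup⟩ := h.exists_jointAtLeast_le hν hρ
  obtain ⟨c, hc, hlow⟩ := h.exists_le_jointExceed hν hρ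
  set l := M * C / c with hl
  have hl0 : 0 ≤ l := by positivity
  have hexp : l < exp (-(-l)) := by
    rw [neg_neg]; linarith [Real.add_one_le_exp l]
  refine ⟨l + 1, ?_⟩
  filter_upwards [hup, h.eventually_ge hexp, h.eventually_mul_scale_lt (l + 1),
    eventually_gt_atTop 0] with s h1 h2 h3 hs
  have ha := h.scale_pos s
  have hG := h.pos s
  have h4 := hlow (s - (l + 1) * a s) (a s) (by linarith) ha
  rw [show s - (l + 1) * a s + a s = s + -l * a s by ring] at h4
  refine le_trans ?_ h4
  have h5 : 0 < s + -l * a s := by nlinarith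
  calc _ ≤ M * (C * (a s * G s / s)) := by gcongr
    _ = c * (a s / s) * (l * G s) := by rw [hl]; field_simp
    _ ≤ c * (a s / (s + -l * a s)) * G (s + -l * a s) := by
      gcongr
      nlinarith

theorem exists_jointAtLeast_le_mul (h : IsGumbelTail G a)
    (hν : ∀ t, ν (Set.Ioi t) = ENNReal.ofReal (G t)) {ρ : ℝ} (hρ : ρ ∈ Set.Ioo (-1 : ℝ) 1)
    {ε : ℝ} (hε : 0 < ε) :
    ∃ k, ∀ᶠ s in atTop,
      (ν.prod uniformCircle).real (jointAtLeast ρ ((s + k * a s) * √((1 + ρ) / 2))) ≤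
        ε * (ν.prod uniformCircle).real (jointExceed ρ (s * √((1 + ρ) / 2))) := by
  obtain ⟨C, hC, hup⟩ := h.exists_jointAtLeast_le hν hρ
  obtain ⟨c, hc, hlow⟩ := h.exists_le_jointExceed hν hρ
  set k := 12 * C / (ε * c) with hk
  have hk0 : 0 < k := by positivity
  have hexp : exp (-k) < 1 / k := by
    rw [Real.exp_neg, ← one_div]
    exact one_div_lt_one_div_of_lt hk0 (by linarith [Real.add_one_le_exp k])
  have he : 1 / 3 < exp (-1) := by
    have := Real.exp_neg_one_gt_d9; linarith
  refine ⟨k, ?_⟩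
  filter_upwards [(h.tendsto_add_mul_scale hk0.le).eventually hup, h.eventually_le hexp,
    h.eventually_ge he, h.eventually_scale_le hk0.le one_lt_two, h.eventually_mul_scale_lt 1,
    eventually_gt_atTop 0] with s h1 h2 h3 h4 h5 hs
  have ha := h.scale_pos s
  have hG := h.pos s
  have h6 := hlow s (a s) hs ha
  have ha' := h.scale_pos (s + k * a s)
  have hG' := h.pos (s + k * a s)
  rw [one_mul] at h3 h5
  calc _ ≤ C * (a (s + k * a s) * G (s + k * a s) / (s + k * a s)) := h1
    _ ≤ C * (2 * a s * (1 / k * G s) / s) := by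
      gcongr
      nlinarith
    _ = ε * (c * (a s / (2 * s)) * (1 / 3 * G s)) := by rw [hk]; field_simp; norm_num
    _ ≤ ε * (c * (a s / (s + a s)) * G (s + a s)) := by
      gcongr
      linarith
    _ ≤ _ := by gcongr

end IsGumbelTail

theorem exists_quantile_of_antitone {D : ℝ → ℝ} (hD : Antitone D) (hpos : ∀ z, 0 < D z)
    (hlim : Tendsto D atTop (nhds 0)) :
    ∃ T : ℝ → ℝ, Tendsto T atTop atTop ∧
      ∀ᶠ u in atTop, (∀ z, T u < z → D z < 1 / u) ∧ ∀ z, z < T u → 1 / u ≤ D z := by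
  have hinv : ∀ z, ∀ᶠ u : ℝ in atTop, 1 / u ≤ D z := by
    intro z
    filter_upwards [eventually_ge_atTop (1 / D z), eventually_gt_atTop 0] with u hu hu0
    exact (one_div_le (hpos z) hu0).mp hu
  have hne : ∀ u : ℝ, 0 < u → {z | D z < 1 / u}.Nonempty := fun u hu =>
    (hlim.eventually_lt_const (one_div_pos.mpr hu)).exists
  have hlb : ∀ z u : ℝ, 1 / u ≤ D z → z ∈ lowerBounds {z | D z < 1 / u} := by
    intro z u h y hy
    by_contra! hcon
    exact absurd (h.trans (hD hcon.le)) (not_le.mpr hy)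
  refine ⟨fun u => sInf {z | D z < 1 / u}, ?_, ?_⟩
  · refine tendsto_atTop.mpr fun K => ?_
    filter_upwards [hinv K, eventually_gt_atTop 0] with u hu hu0
    exact le_csInf (hne u hu0) (hlb K u hu)
  · filter_upwards [hinv 0, eventually_gt_atTop 0] with u hu hu0
    refine ⟨fun z hz => ?_, fun z hz => ?_⟩
    · obtain ⟨y, hy, hyz⟩ := exists_lt_of_csInf_lt (hne u hu0) hz
      exact (hD hyz.le).trans_lt hy
    · by_contra! hcon
      exact absurd (csInf_le ⟨0, hlb 0 u hu⟩ hcon) (not_le.mpr hz)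

theorem jointExceed_anti (ρ : ℝ) : Antitone (jointExceed ρ) :=
  fun _ _ h _ hq => ⟨h.trans_lt hq.1, h.trans_lt hq.2⟩

theorem jointAtLeast_anti (ρ : ℝ) : Antitone (jointAtLeast ρ) :=
  fun _ _ h _ hq => ⟨h.trans hq.1, h.trans hq.2⟩

theorem measurableSet_jointExceed (ρ t : ℝ) : MeasurableSet (jointExceed ρ t) :=
  (measurableSet_radial_lt t).inter (measurableSet_lt measurable_const (measurable_radial_snd ρ))

/-- If `F` is in the Gumbel max-domain of attraction with scaling function `w`, and
`w(α_ρ u)/w(u) → ∞` where `α_ρ = √(2/(1+ρ))`, then `S_u(x,y) → ∞` for `x,y > 1` and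
`S_u(x,y) → 0` for `x,y ∈ (0,1)`. -/
theorem residual_dependence_degenerate
    {Ω : Type*} [MeasurableSpace Ω] (μ : Measure Ω) [IsProbabilityMeasure μ]
    (R U₁ U₂ : Ω → ℝ) (ρ : ℝ) (hρ : ρ ∈ Set.Ioo (-1 : ℝ) 1)
    (hRmeas : Measurable R) (hUmeas : Measurable fun ω => (U₁ ω, U₂ ω))
    (hIndep : IndepFun R (fun ω => (U₁ ω, U₂ ω)) μ)
    (hUnif : Measure.map (fun ω => (U₁ ω, U₂ ω)) μ = uniformCircle)
    (X₁ X₂ : Ω → ℝ)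
    (hX₁ : X₁ = fun ω => R ω * U₁ ω)
    (hX₂ : X₂ = fun ω => R ω * (ρ * U₁ ω + Real.sqrt (1 - ρ ^ 2) * U₂ ω))
    -- `F` is the distribution function of the positive random radius `R`
    (F : ℝ → ℝ) (hF : F = fun t => (μ {ω | R ω ≤ t}).toReal)
    (hF0 : F 0 = 0) (hFlt : ∀ x > (0 : ℝ), F x < 1)
    -- `Q` is the distribution function of `X₁`
    (Q : ℝ → ℝ) (hQ : Q = fun t => (μ {ω | X₁ ω ≤ t}).toReal)
    -- `F` is in the Gumbel max-domain of attraction with positive scaling function `w`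
    (w : ℝ → ℝ) (hw : ∀ u, 0 < w u)
    (hGumbel : ∀ x : ℝ,
      Tendsto (fun u => (1 - F (u + x / w u)) / (1 - F u)) atTop (nhds (Real.exp (-x))))
    -- the joint survival function `S̃_u(x,y)`
    (Stilde : ℝ → ℝ → ℝ → ℝ)
    (hStilde : ∀ u x y,
      Stilde u x y = (μ {ω | 1 - x / u < Q (X₁ ω) ∧ 1 - y / u < Q (X₂ ω)}).toReal)
    (αρ : ℝ) (hαρ : αρ = Real.sqrt (2 / (1 + ρ)))
    -- condition (2.5): `w(α_ρ u)/w(u) → ∞`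
    (hwinf : Tendsto (fun u => w (αρ * u) / w u) atTop atTop) :
    (∀ x y : ℝ, 1 < x → 1 < y →
        Tendsto (fun u => Stilde u x y / Stilde u 1 1) atTop atTop) ∧
    (∀ x y : ℝ, x ∈ Set.Ioo (0 : ℝ) 1 → y ∈ Set.Ioo (0 : ℝ) 1 →
        Tendsto (fun u => Stilde u x y / Stilde u 1 1) atTop (nhds 0)) := by
  set ν := μ.map R with hνdef
  have hνprob : IsProbabilityMeasure ν := Measure.isProbabilityMeasure_map hRmeas.aemeasurable
  set a : ℝ → ℝ := fun u => (w u)⁻¹ with ha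
  set G : ℝ → ℝ := fun t => 1 - F t with hGdef
  have hFcdf : ∀ t, F t = cdf ν t := by
    intro t
    rw [cdf_eq_real, measureReal_def, hνdef, Measure.map_apply hRmeas measurableSet_Iic, hF]
    rfl
  have hFmono : Monotone F := fun s t hst => by
    rw [hFcdf, hFcdf]; exact monotone_cdf ν hst
  have hν : ∀ t, ν (Set.Ioi t) = ENNReal.ofReal (G t) := by
    intro t
    rw [← Set.compl_Iic, prob_compl_eq_one_sub measurableSet_Iic, hGdef]
    simp only [hFcdf]
    rw [ENNReal.ofReal_sub _ (cdf_nonneg _ _), ENNReal.ofReal_one, ofReal_cdf]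
  have hFle : ∀ t ≤ 0, F t = 0 := fun t ht => by
    refine le_antisymm (hF0 ▸ hFmono ht) ?_
    rw [hFcdf]; exact cdf_nonneg _ _
  have hG : IsGumbelTail G a :=
    { antitone := fun s t hst => sub_le_sub_left (hFmono hst) 1
      pos := fun t => by
        rcases le_or_gt t 0 with ht | ht
        · simp [hGdef, hFle t ht]
        · exact sub_pos.mpr (hFlt t ht)
      eq_one := fun t ht => by simp [hGdef, hFle t ht]
      tendsto_zero := by
        have := (tendsto_cdf_atTop ν).const_sub 1
        rw [sub_self] at this
        exact this.congr fun t => by simp only [hGdef, hFcdf]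
      scale_pos := fun u => inv_pos.mpr (hw u)
      tendsto_ratio := hGumbel }
  set P := ν.prod uniformCircle with hP
  have hmeas : Measurable fun ω => (R ω, (U₁ ω, U₂ ω)) := hRmeas.prodMk hUmeas
  have hmap : μ.map (fun ω => (R ω, (U₁ ω, U₂ ω))) = P := by
    rw [(indepFun_iff_map_prod_eq_prod_map_map hRmeas.aemeasurable hUmeas.aemeasurable).mp hIndep,
      hUnif]
  have hPapply : ∀ A : Set (ℝ × ℝ × ℝ), MeasurableSet A →
      μ.real {ω | (R ω, (U₁ ω, U₂ ω)) ∈ A} = P.real A := by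
    intro A hA
    rw [← hmap, map_measureReal_apply hmeas hA]
    rfl
  have hX₁m : Measurable X₁ := by
    rw [hX₁]; exact hRmeas.mul (measurable_fst.comp hUmeas)
  have hX₁prob : IsProbabilityMeasure (μ.map X₁) :=
    Measure.isProbabilityMeasure_map hX₁m.aemeasurable
  have hQcdf : ∀ t, Q t = cdf (μ.map X₁) t := by
    intro t
    rw [cdf_eq_real, map_measureReal_apply hX₁m measurableSet_Iic, hQ]
    rfl
  set D : ℝ → ℝ := fun t => P.real {q | t < q.1 * q.2.1} with hDdef
  have hDQ : ∀ t, D t = 1 - Q t := by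
    intro t
    rw [hDdef, hQcdf, cdf_eq_real, ← probReal_compl_eq_one_sub measurableSet_Iic,
      map_measureReal_apply hX₁m measurableSet_Iic.compl]
    simp only
    rw [← hPapply _ (measurableSet_radial_lt t), Set.compl_Iic, hX₁]
    rfl
  have hDanti : Antitone D := fun s t hst => by
    rw [hDQ, hDQ, hQcdf, hQcdf]; exact sub_le_sub_left (monotone_cdf _ hst) 1
  have hα0 : 0 < αρ := by
    have : 0 < 1 + ρ := by linarith [hρ.1]
    rw [hαρ]; positivity
  set b := √((1 + ρ) / 2) with hb
  have hαb : αρ * b = 1 := by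
    have : 0 < 1 + ρ := by linarith [hρ.1]
    rw [hαρ, hb, ← Real.sqrt_mul (by positivity), div_mul_div_cancel₀ this.ne', div_self two_ne_zero,
      Real.sqrt_one]
  have hb0 : 0 < b := by
    by_contra! hcon
    nlinarith
  have hJpos : ∀ t, 0 < t → 0 < P.real (jointExceed ρ t) := by
    intro t ht
    have := hG.jointExceed_pos hν hρ (mul_pos hα0 ht)
    rwa [show αρ * t * b = t by linear_combination t * hαb] at this
  have hDpos : ∀ t, 0 < D t := by
    intro t
    refine lt_of_lt_of_le ((hJpos (max t 1) (by positivity)).trans_le ?_)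
      (hDanti (le_max_left t 1))
    exact measureReal_mono fun q hq => hq.1
  have hDlim : Tendsto D atTop (nhds 0) := by
    have := (tendsto_cdf_atTop (μ.map X₁)).const_sub 1
    rw [sub_self] at this
    exact this.congr fun t => by rw [hDQ, hQcdf]
  obtain ⟨T, hT, hTq⟩ := exists_quantile_of_antitone hDanti hDpos hDlim
  have hS : ∀ u x y, Stilde u x y = μ.real {ω | D (X₁ ω) < x / u ∧ D (X₂ ω) < y / u} := by
    intro u x y
    rw [hStilde, measureReal_def]
    congr 3
    ext ω
    rw [hDQ, hDQ, sub_lt_comm, sub_lt_comm (b := Q (X₂ ω))]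
  have hexceed_le : ∀ u x y t, (∀ z, t < z → D z < x / u) → (∀ z, t < z → D z < y / u) →
      P.real (jointExceed ρ t) ≤ Stilde u x y := by
    intro u x y t h1 h2
    rw [hS, ← hPapply _ (measurableSet_jointExceed ρ t), hX₁, hX₂]
    exact measureReal_mono fun ω hω => ⟨h1 _ hω.1, h2 _ hω.2⟩
  have hle_atLeast : ∀ u x y t, (∀ z, D z < x / u → t ≤ z) → (∀ z, D z < y / u → t ≤ z) →
      Stilde u x y ≤ P.real (jointAtLeast ρ t) := by
    intro u x y t h1 h2
    rw [hS, ← hPapply _ (measurableSet_jointAtLeast ρ t), hX₁, hX₂]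
    exact measureReal_mono fun ω hω => ⟨h1 _ hω.1, h2 _ hω.2⟩
  have hTα : Tendsto (fun u => αρ * T u) atTop atTop := hT.const_mul_atTop hα0
  have hshift : ∀ c > 0, ∀ k, ∀ᶠ u in atTop, k * a (αρ * T u) * b ≤ c * a (T u) := by
    intro c hc k
    filter_upwards [(hwinf.comp hT).eventually_ge_atTop (k * b / c)] with u hu
    simp only [Function.comp_apply] at hu
    have h1 := hw (T u)
    have h2 := hw (αρ * T u)
    rw [div_le_div_iff₀ hc h1] at hu
    simp only [ha]
    rw [mul_right_comm, ← div_eq_mul_inv, ← div_eq_mul_inv, div_le_div_iff₀ h2 h1]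
    linarith
  have hone : ∀ᶠ u in atTop, P.real (jointExceed ρ (T u)) ≤ Stilde u 1 1 := by
    filter_upwards [hTq] with u hu
    exact hexceed_le u 1 1 _ hu.1 hu.1
  have hTb : ∀ u, αρ * T u * b = T u := fun u => by linear_combination T u * hαb
  refine ⟨fun x y hx hy => ?_, fun x y hx hy => ?_⟩
  · obtain ⟨c, hc, hbal⟩ := hG.exists_survival_sub_le hν (lt_min hx hy)
    refine tendsto_atTop.mpr fun M => ?_
    obtain ⟨k, hk⟩ := hG.exists_mul_jointAtLeast_le hν hρ (le_max_right M 0)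
    filter_upwards [hT.eventually hbal, hTα.eventually hk, hshift c hc k, hTq, hone,
      hT.eventually_gt_atTop 0, eventually_gt_atTop 0] with u h1 h2 h3 h4 h5 h6 hu
    have hat := hG.scale_pos (T u)
    have hD1 : D (T u - c * a (T u)) < min x y / u := by
      refine h1.trans_lt ?_
      rw [div_eq_mul_one_div]
      exact mul_lt_mul_of_pos_left (h4.1 _ (by nlinarith)) (by positivity)
    have hlow : P.real (jointExceed ρ (T u - c * a (T u))) ≤ Stilde u x y := by
      apply hexceed_le <;> intro z hz <;> refine (hDanti hz.le).trans_lt (hD1.trans_le ?_) <;>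
        gcongr
      · exact min_le_left _ _
      · exact min_le_right _ _
    have hup : Stilde u 1 1 ≤ P.real (jointAtLeast ρ (T u)) := by
      have : ∀ z, D z < 1 / u → T u ≤ z := fun z hz => by
        by_contra! hcon
        exact absurd (h4.2 z hcon) (not_le.mpr hz)
      exact hle_atLeast u 1 1 _ this this
    rw [le_div_iff₀ ((hJpos _ h6).trans_le h5)]
    have hmono : P.real (jointExceed ρ ((αρ * T u - k * a (αρ * T u)) * b)) ≤
        P.real (jointExceed ρ (T u - c * a (T u))) := by
      refine measureReal_mono (jointExceed_anti ρ ?_)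
      linarith [hTb u]
    rw [hTb] at h2
    have hnn : 0 ≤ Stilde u 1 1 := measureReal_nonneg.trans h5
    calc M * Stilde u 1 1 ≤ max M 0 * Stilde u 1 1 := by gcongr; exact le_max_left _ _
      _ ≤ max M 0 * P.real (jointAtLeast ρ (T u)) := by gcongr
      _ ≤ _ := h2.trans (hmono.trans hlow)
  · have hm0 : 0 < max x y := lt_max_of_lt_left hx.1
    obtain ⟨c, hc, hbal⟩ := hG.exists_survival_sub_le hν
      ((one_lt_div hm0).mpr (max_lt hx.2 hy.2))
    have hsmall : ∀ ε > 0, ∀ᶠ u in atTop, Stilde u x y / Stilde u 1 1 ≤ ε := by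
      intro ε hε
      obtain ⟨k, hk⟩ := hG.exists_jointAtLeast_le_mul hν hρ hε
      filter_upwards [hT.eventually hbal, hTα.eventually hk, hshift c hc k, hTq, hone,
        hT.eventually_gt_atTop 0, eventually_gt_atTop 0] with u h1 h2 h3 h4 h5 h6 hu
      have hat := hG.scale_pos (T u)
      have hD1 : max x y / u ≤ D (T u + c * a (T u)) := by
        have h7 := (h4.2 _ (show T u - c * a (T u) < T u by nlinarith)).trans h1
        rw [one_div_mul_eq_div, div_le_div_iff₀ hu hm0] at h7
        rw [div_le_iff₀ hu]; linarith
      have hup : Stilde u x y ≤ P.real (jointAtLeast ρ (T u + c * a (T u))) := by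
        have : ∀ v ≤ max x y, ∀ z, D z < v / u → T u + c * a (T u) ≤ z := by
          intro v hv z hz
          by_contra! hcon
          have : v / u ≤ max x y / u := by gcongr
          linarith [hDanti hcon.le]
        exact hle_atLeast u x y _ (this x (le_max_left _ _)) (this y (le_max_right _ _))
      rw [div_le_iff₀ ((hJpos _ h6).trans_le h5)]
      have hmono : P.real (jointAtLeast ρ (T u + c * a (T u))) ≤
          P.real (jointAtLeast ρ ((αρ * T u + k * a (αρ * T u)) * b)) := by
        refine measureReal_mono (jointAtLeast_anti ρ ?_)
        linarith [hTb u]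
      rw [hTb] at h2
      calc _ ≤ _ := hup.trans (hmono.trans h2)
        _ ≤ ε * Stilde u 1 1 := by gcongr
    refine tendsto_order.mpr ⟨fun b' hb' => Eventually.of_forall fun u => ?_, fun ε hε => ?_⟩
    · refine hb'.trans_le (div_nonneg ?_ ?_) <;> rw [hS] <;> exact measureReal_nonneg
    · filter_upwards [hsmall (ε / 2) (by positivity)] with u hu
      linarith
end

section
/- Suppose F is in the Gumbel max-domain of attraction with positive scaling function w, and that for some θ ∈ [0,∞), lim_{u→∞} w(cu)/w(u) = c^{θ−1} for every c > 0. Then for every x, y ∈ (0,∞), lim_{u→∞} S_u(x,y) = (xy)^{1/(2η)}, where η := ((1+ρ)/2)^{θ/2} = α_ρ^{−θ} ∈ (0,1]. -/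
open MeasureTheory ProbabilityTheory Filter Real

/-- `H` is a survival function of a positive random variable with infinite right endpoint which
lies in the Gumbel max-domain of attraction with auxiliary function `h` (the reciprocal of the
scaling function). -/
structure IsGumbelTail_s1 (H h : ℝ → ℝ) : Prop where
  anti : Antitone H
  pos : ∀ t, 0 < H t
  eq_one : ∀ t ≤ 0, H t = 1
  tendsto_zero : Tendsto H atTop (nhds 0)
  aux_pos : ∀ t, 0 < h t
  gumbel : ∀ x : ℝ, Tendsto (fun u => H (u + x * h u) / H u) atTop (nhds (Real.exp (-x)))

namespace IsGumbelTail_s1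

variable {H h : ℝ → ℝ}

/-- The Gumbel limit is attained along convergent sequences of arguments. -/
theorem tendsto_comp (hH : IsGumbelTail_s1 H h) {ι : Type*} {l : Filter ι} {r v : ι → ℝ} {a : ℝ}
    (hr : Tendsto r l atTop) (hv : Tendsto v l (nhds a)) :
    Tendsto (fun i => H (r i + v i * h (r i)) / H (r i)) l (nhds (Real.exp (-a))) := by
  have hc : ContinuousAt (fun x : ℝ => Real.exp (-x)) a := by fun_prop
  rw [tendsto_order]
  constructor
  · intro m hm
    obtain ⟨b, hab, hb⟩ : ∃ b, a < b ∧ m < Real.exp (-b) := by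
      have h1 : ∀ᶠ x in nhdsWithin a (Set.Ioi a), m < Real.exp (-x) :=
        nhdsWithin_le_nhds (hc.eventually (lt_mem_nhds hm))
      obtain ⟨b, hb, hb'⟩ := (h1.and self_mem_nhdsWithin).exists
      exact ⟨b, hb', hb⟩
    filter_upwards [((hH.gumbel b).comp hr).eventually (lt_mem_nhds hb),
      hv.eventually (gt_mem_nhds hab)] with i h1 h2
    refine h1.trans_le ?_
    have := hH.pos (r i)
    have := (hH.aux_pos (r i)).le
    simp only [Function.comp]
    gcongr
    apply hH.anti
    gcongr
  · intro m hm
    obtain ⟨b, hab, hb⟩ : ∃ b, b < a ∧ Real.exp (-b) < m := by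
      have h1 : ∀ᶠ x in nhdsWithin a (Set.Iio a), Real.exp (-x) < m :=
        nhdsWithin_le_nhds (hc.eventually (gt_mem_nhds hm))
      obtain ⟨b, hb, hb'⟩ := (h1.and self_mem_nhdsWithin).exists
      exact ⟨b, hb', hb⟩
    filter_upwards [((hH.gumbel b).comp hr).eventually (gt_mem_nhds hb),
      hv.eventually (lt_mem_nhds hab)] with i h1 h2
    refine lt_of_le_of_lt ?_ h1
    have := hH.pos (r i)
    have := (hH.aux_pos (r i)).le
    simp only [Function.comp]
    gcongr
    apply hH.anti
    gcongr

theorem tendsto_aux_div_id (hH : IsGumbelTail_s1 H h) :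
    Tendsto (fun r => h r / r) atTop (nhds 0) := by
  rw [tendsto_order]
  constructor
  · intro m hm
    filter_upwards [eventually_gt_atTop 0] with r hr
    exact hm.trans (div_pos (hH.aux_pos r) hr)
  · intro m hm
    have h1 := (hH.gumbel (-(1 / m))).eventually
      (gt_mem_nhds (lt_add_one (Real.exp (-(-(1 / m))))))
    set K := Real.exp (-(-(1 / m))) + 1 with hK
    have hKpos : 0 < K := by positivity
    filter_upwards [h1, hH.tendsto_zero.eventually (gt_mem_nhds (inv_pos.2 hKpos)),
      eventually_gt_atTop 0] with r h2 h3 hr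
    by_contra! hcon
    have h4 : r + -(1 / m) * h r ≤ 0 := by
      rw [le_div_iff₀ hr] at hcon
      have : r ≤ 1 / m * h r := by
        rw [one_div, inv_mul_eq_div, le_div_iff₀ hm]; linarith
      linarith
    rw [hH.eq_one _ h4, div_lt_iff₀ (hH.pos r)] at h2
    have h5 := mul_lt_mul_of_pos_left h3 hKpos
    rw [mul_inv_cancel₀ hKpos.ne'] at h5
    linarith

/-- Upper half of the self-neglecting property of the auxiliary function. -/
theorem eventually_aux_add_le (hH : IsGumbelTail_s1 H h) :
    ∀ᶠ r in atTop, h (r + h r) ≤ 3 / 2 * h r := by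
  have hs : Tendsto (fun r => r + h r) atTop atTop :=
    tendsto_atTop_mono (fun r => by simpa using (hH.aux_pos r).le) tendsto_id
  have h1 := (hH.gumbel 1).comp hs
  have h2 := (hH.gumbel 1).mul h1
  have h3 := hH.gumbel (5 / 2)
  have h4 : Real.exp (-(5 / 2)) < Real.exp (-1) * Real.exp (-1) := by
    rw [← Real.exp_add, Real.exp_lt_exp]; norm_num
  filter_upwards [h3.eventually_lt h2 h4] with r hr
  by_contra! hcon
  refine absurd hr (not_lt.2 ?_)
  simp only [Function.comp, one_mul]
  rw [div_mul_div_cancel₀' (hH.pos _).ne']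
  have := hH.pos r
  gcongr
  apply hH.anti
  linarith

theorem eventually_add_aux_le (hH : IsGumbelTail_s1 H h) :
    ∀ᶠ r in atTop, H (r + h r) ≤ 4 / 9 * H r := by
  have h1 : Real.exp (-1) < 4 / 9 := by
    have := Real.exp_neg_one_lt_d9
    linarith
  filter_upwards [(hH.gumbel 1).eventually (gt_mem_nhds h1)] with r hr
  rw [one_mul, div_lt_iff₀ (hH.pos r)] at hr
  exact hr.le

theorem eventually_forall_le (hH : IsGumbelTail_s1 H h) :
    ∀ᶠ r in atTop, ∀ v, 0 ≤ v → H (r + v * h r) ≤ 9 / 4 * H r / (1 + v / 2) ^ 2 := by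
  obtain ⟨r₀, hr₀⟩ := eventually_atTop.1 (hH.eventually_aux_add_le.and hH.eventually_add_aux_le)
  have key : ∀ n : ℕ, ∀ r ≥ r₀, H (r + 2 * ((3 / 2) ^ n - 1) * h r) ≤ (4 / 9) ^ n * H r := by
    intro n
    induction n with
    | zero => intro r _; simp
    | succ n ih =>
      intro r hr
      obtain ⟨h1, h2⟩ := hr₀ r hr
      have h3 := ih (r + h r) (by linarith [hH.aux_pos r])
      have h4 : (1 : ℝ) ≤ (3 / 2) ^ n := one_le_pow₀ (by norm_num)
      calc H (r + 2 * ((3 / 2) ^ (n + 1) - 1) * h r)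
          ≤ H (r + h r + 2 * ((3 / 2) ^ n - 1) * h (r + h r)) := by
            apply hH.anti
            have := mul_le_mul_of_nonneg_left h1 (by linarith : 0 ≤ 2 * ((3 / 2 : ℝ) ^ n - 1))
            rw [pow_succ]
            nlinarith
        _ ≤ (4 / 9) ^ n * H (r + h r) := h3
        _ ≤ (4 / 9) ^ n * (4 / 9 * H r) := by gcongr
        _ = _ := by ring
  filter_upwards [eventually_ge_atTop r₀] with r hr v hv
  obtain ⟨n, hn1, hn2⟩ := exists_nat_pow_near (by linarith : (1 : ℝ) ≤ 1 + v / 2)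
    (by norm_num : (1 : ℝ) < 3 / 2)
  have hpos := hH.pos r
  calc H (r + v * h r) ≤ H (r + 2 * ((3 / 2) ^ n - 1) * h r) := by
        apply hH.anti
        have := (hH.aux_pos r).le
        gcongr
        linarith
    _ ≤ (4 / 9) ^ n * H r := key n r hr
    _ ≤ 9 / 4 * H r / (1 + v / 2) ^ 2 := by
        rw [le_div_iff₀ (by positivity)]
        have h5 : (1 + v / 2) ^ 2 ≤ ((3 / 2 : ℝ) ^ (n + 1)) ^ 2 := by gcongr
        have h6 : (4 / 9 : ℝ) ^ n * ((3 / 2 : ℝ) ^ (n + 1)) ^ 2 = 9 / 4 := by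
          rw [← pow_mul, mul_comm (n + 1) 2, pow_mul, pow_succ, ← mul_assoc, ← mul_pow]
          norm_num
        calc (4 / 9) ^ n * H r * (1 + v / 2) ^ 2
            ≤ (4 / 9) ^ n * H r * ((3 / 2 : ℝ) ^ (n + 1)) ^ 2 := by gcongr
          _ = (4 / 9 : ℝ) ^ n * ((3 / 2 : ℝ) ^ (n + 1)) ^ 2 * H r := by ring
          _ = _ := by rw [h6]

/-- Uniform integrable bound for the normalized tail. -/
theorem exists_eventually_forall_le (hH : IsGumbelTail_s1 H h) {C : ℝ} (hC : 0 ≤ C) :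
    ∃ K, 0 ≤ K ∧ ∀ᶠ r in atTop, ∀ p, 0 ≤ p → H (r + (p - C) * h r) ≤ K * H r / (1 + p ^ 2) := by
  refine ⟨36 + (Real.exp C + 1) * (1 + 4 * C ^ 2), by positivity, ?_⟩
  have h1 := (hH.gumbel (-C)).eventually (gt_mem_nhds (lt_add_one _))
  filter_upwards [h1, hH.eventually_forall_le] with r h1 h2 p hp
  have hpos := hH.pos r
  rw [neg_neg, div_lt_iff₀ hpos] at h1
  rw [le_div_iff₀ (by positivity)]
  rcases le_total p (2 * C) with hpC | hpC
  · have h3 : H (r + (p - C) * h r) ≤ (Real.exp C + 1) * H r := by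
      refine le_trans (hH.anti ?_) h1.le
      have := (hH.aux_pos r).le
      gcongr
      linarith
    have h4 : 1 + p ^ 2 ≤ 1 + 4 * C ^ 2 := by nlinarith
    calc H (r + (p - C) * h r) * (1 + p ^ 2)
        ≤ (Real.exp C + 1) * H r * (1 + 4 * C ^ 2) := by gcongr
      _ = (Real.exp C + 1) * (1 + 4 * C ^ 2) * H r := by ring
      _ ≤ _ := by gcongr; linarith
  · have h3 := h2 (p - C) (by linarith)
    rw [le_div_iff₀ (by nlinarith)] at h3
    have h4 : 1 + p ^ 2 ≤ 16 * (1 + (p - C) / 2) ^ 2 := by nlinarith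
    have := hH.pos (r + (p - C) * h r)
    calc H (r + (p - C) * h r) * (1 + p ^ 2)
        ≤ H (r + (p - C) * h r) * (16 * (1 + (p - C) / 2) ^ 2) := by gcongr
      _ ≤ 36 * H r := by linarith
      _ ≤ _ := by gcongr; have := Real.exp_pos C; nlinarith [sq_nonneg C]

end IsGumbelTail_s1

theorem intervalIntegral_period_eq_mul_integral {f : ℝ → ℝ} (hf : Function.Periodic f (2 * π))
    {ε : ℝ} (hε : 0 < ε) (c : ℝ) :
    ∫ φ in (0 : ℝ)..2 * π, f φ =
      ε * ∫ τ, (Set.Ioc (-(π / ε)) (π / ε)).indicator (fun τ => f (c + ε * τ)) τ := by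
  have h1 : -(π / ε) ≤ π / ε := by
    have := div_pos Real.pi_pos hε
    linarith
  rw [integral_indicator measurableSet_Ioc, ← intervalIntegral.integral_of_le h1, ← smul_eq_mul ε,
    intervalIntegral.smul_integral_comp_add_mul]
  have h2 := hf.intervalIntegral_add_eq 0 (c - π)
  rw [zero_add] at h2
  rw [h2]
  congr 1 <;> field_simp <;> ring

/-- Laplace-type limit for integrals over a period of functions concentrating near `c`. -/
theorem tendsto_intervalIntegral_period_div {ι : Type*} {l : Filter ι} [l.IsCountablyGenerated]
    {f : ι → ℝ → ℝ} {ε N : ι → ℝ} {c : ℝ} {g bound : ℝ → ℝ}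
    (hmeas : ∀ i, Measurable (f i)) (hper : ∀ i, Function.Periodic (f i) (2 * π))
    (hε : ∀ᶠ i in l, 0 < ε i) (hε0 : Tendsto ε l (nhds 0)) (hN : ∀ i, 0 < N i)
    (hnn : ∀ i φ, 0 ≤ f i φ)
    (hle : ∀ᶠ i in l, ∀ τ, |ε i * τ| ≤ π → f i (c + ε i * τ) ≤ N i * bound τ)
    (hbound : Integrable bound) (hbound_nn : ∀ τ, 0 ≤ bound τ)
    (hlim : ∀ τ, Tendsto (fun i => f i (c + ε i * τ) / N i) l (nhds (g τ))) :
    Tendsto (fun i => (∫ φ in (0 : ℝ)..2 * π, f i φ) / (ε i * N i)) l (nhds (∫ τ, g τ)) := by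
  have key : Tendsto (fun i => ∫ τ, (Set.Ioc (-(π / ε i)) (π / ε i)).indicator
      (fun τ => f i (c + ε i * τ) / N i) τ) l (nhds (∫ τ, g τ)) := by
    apply tendsto_integral_filter_of_dominated_convergence bound _ _ hbound
    · refine ae_of_all _ fun τ => ?_
      refine (hlim τ).congr' ?_
      have h1 : Tendsto (fun i => ε i * |τ|) l (nhds 0) := by simpa using hε0.mul_const |τ|
      filter_upwards [hε, h1.eventually (gt_mem_nhds Real.pi_pos)] with i h2 h3
      rw [Set.indicator_of_mem]
      have h4 : |τ| < π / ε i := by rw [lt_div_iff₀ h2]; linarith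
      exact ⟨(abs_lt.1 h4).1, (abs_lt.1 h4).2.le⟩
    · refine Eventually.of_forall fun i => Measurable.aestronglyMeasurable ?_
      refine Measurable.indicator ?_ measurableSet_Ioc
      exact ((hmeas i).comp (by fun_prop)).div_const _
    · filter_upwards [hε, hle] with i h2 h3
      refine ae_of_all _ fun τ => ?_
      by_cases hτ : τ ∈ Set.Ioc (-(π / ε i)) (π / ε i)
      · rw [Set.indicator_of_mem hτ, Real.norm_of_nonneg (div_nonneg (hnn _ _) (hN i).le),
          div_le_iff₀ (hN i), mul_comm (bound τ)]
        refine h3 τ ?_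
        rw [abs_mul, abs_of_pos h2, mul_comm, ← le_div_iff₀ h2]
        exact abs_le.2 ⟨hτ.1.le, hτ.2⟩
      · rw [Set.indicator_of_notMem hτ, norm_zero]
        exact hbound_nn τ
  refine key.congr' ?_
  filter_upwards [hε] with i hi
  rw [intervalIntegral_period_eq_mul_integral (hper i) hi c, mul_div_mul_left _ _ hi.ne',
    ← integral_div]
  congr 1 with τ
  by_cases hτ : τ ∈ Set.Ioc (-(π / ε i)) (π / ε i)
  · rw [Set.indicator_of_mem hτ, Set.indicator_of_mem hτ]
  · rw [Set.indicator_of_notMem hτ, Set.indicator_of_notMem hτ, zero_div]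

/-- Integration in polar coordinates: if `R` is independent of a point distributed uniformly on
the circle, probabilities are averages over the angle. -/
theorem measureReal_eq_intervalIntegral_of_uniformCircle {Ω : Type*} [MeasurableSpace Ω]
    {μ : Measure Ω} [IsProbabilityMeasure μ] {R : Ω → ℝ} {U : Ω → ℝ × ℝ} (hR : Measurable R)
    (hU : Measurable U) (hind : IndepFun R U μ) (hunif : Measure.map U μ = uniformCircle)
    {D : Set (ℝ × ℝ × ℝ)} (hD : MeasurableSet D) :
    μ.real {ω | (R ω, U ω) ∈ D} =
      (2 * π)⁻¹ * ∫ φ in (0 : ℝ)..2 * π, μ.real {ω | (R ω, (Real.cos φ, Real.sin φ)) ∈ D} := by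
  have hpi : (0 : ℝ) < 2 * π := by positivity
  have hcs : Measurable fun θ : ℝ => (Real.cos θ, Real.sin θ) := by fun_prop
  have : IsProbabilityMeasure (Measure.map R μ) := Measure.isProbabilityMeasure_map hR.aemeasurable
  have : IsProbabilityMeasure uniformCircle := by
    rw [← hunif]; exact Measure.isProbabilityMeasure_map hU.aemeasurable
  have h1 := (indepFun_iff_map_prod_eq_prod_map_map hR.aemeasurable hU.aemeasurable).1 hind
  have h2 : μ {ω | (R ω, U ω) ∈ D} = ((Measure.map R μ).prod uniformCircle) D := by
    rw [← hunif, ← h1, Measure.map_apply (hR.prodMk hU) hD]; rfl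
  have h3 := measurable_measure_prodMk_right (μ := Measure.map R μ) hD
  have h4 : ∀ y, Measure.map R μ ((fun x => (x, y)) ⁻¹' D) = μ {ω | (R ω, y) ∈ D} := fun y => by
    rw [Measure.map_apply hR (measurable_prodMk_right hD)]; rfl
  rw [measureReal_def, h2, Measure.prod_apply_symm hD, uniformCircle, lintegral_map h3 hcs,
    lintegral_smul_measure, smul_eq_mul, ENNReal.toReal_mul, ENNReal.toReal_inv,
    ENNReal.toReal_ofReal hpi.le, intervalIntegral.integral_of_le hpi.le]
  congr 1
  refine (integral_toReal (h3.comp hcs).aemeasurable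
    (ae_of_all _ fun _ => measure_lt_top _ _)).symm.trans ?_
  simp only [Function.comp, h4, measureReal_def]

theorem measurable_measureReal_angle {Ω : Type*} [MeasurableSpace Ω]
    {μ : Measure Ω} [IsProbabilityMeasure μ] {R : Ω → ℝ} (hR : Measurable R)
    {D : Set (ℝ × ℝ × ℝ)} (hD : MeasurableSet D) :
    Measurable fun φ : ℝ => μ.real {ω | (R ω, (Real.cos φ, Real.sin φ)) ∈ D} := by
  have hcs : Measurable fun p : Ω × ℝ => (R p.1, (Real.cos p.2, Real.sin p.2)) := by fun_prop
  exact (measurable_measure_prodMk_right (μ := μ) (hcs hD)).ennreal_toReal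

theorem measureReal_lt_mul_le {Ω : Type*} [MeasurableSpace Ω]
    {μ : Measure Ω} [IsProbabilityMeasure μ] {R : Ω → ℝ} (hR : ∀ᵐ ω ∂μ, 0 < R ω)
    {m k q : ℝ} (hm : 0 < m) (hq : 0 ≤ q) (hk : 0 < k → k ≤ 1 - q) :
    μ.real {ω | m < R ω * k} ≤ μ.real {ω | m * (1 + q) < R ω} := by
  refine ENNReal.toReal_mono (measure_ne_top _ _) (measure_mono_ae ?_)
  filter_upwards [hR] with ω h1 (h2 : m < R ω * k)
  change m * (1 + q) < R ω
  have h3 : 0 < k := by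
    by_contra! h
    nlinarith
  have h4 := hk h3
  have h5 : m < R ω * (1 - q) := h2.trans_le (by gcongr)
  nlinarith [mul_nonneg h1.le (sq_nonneg q)]

theorem measureReal_lt_mul_eq {Ω : Type*} [MeasurableSpace Ω]
    {μ : Measure Ω} {R : Ω → ℝ} {m k : ℝ} (hk : 0 < k) :
    μ.real {ω | m < R ω * k} = μ.real {ω | m / k < R ω} := by
  simp only [div_lt_iff₀ hk]

theorem tendsto_threshold_div {ι : Type*} {l : Filter ι} {σ k r h : ι → ℝ} {A L : ℝ}
    (hh : ∀ i, 0 < h i) (hσ : Tendsto (fun i => (σ i - r i) / h i) l (nhds A))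
    (hk : Tendsto k l (nhds 1)) (hL : Tendsto (fun i => (1 - k i) / (h i / r i)) l (nhds L)) :
    Tendsto (fun i => (σ i / k i - r i) / h i) l (nhds (A + L)) := by
  have h1 := (hσ.add hL).div hk one_ne_zero
  rw [div_one] at h1
  refine h1.congr' ?_
  filter_upwards [hk.eventually (lt_mem_nhds one_pos)] with i hi
  have := hh i
  simp only [Pi.div_apply]
  field_simp
  ring

theorem tendsto_one_sub_cos_sub_div {ι : Type*} {l : Filter ι} {ε : ι → ℝ}
    (hε : ∀ᶠ i in l, 0 < ε i) (hε0 : Tendsto ε l (nhds 0)) (T τ : ℝ) :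
    Tendsto (fun i => (1 - (Real.cos (ε i * τ) - T * Real.sin (ε i * τ))) / ε i) l
      (nhds (T * τ)) := by
  have h1 : HasDerivAt (fun x : ℝ => 1 - (Real.cos (x * τ) - T * Real.sin (x * τ))) (T * τ) 0 := by
    have h2 : HasDerivAt (fun x : ℝ => x * τ) τ 0 := by
      simpa using (hasDerivAt_id (0 : ℝ)).mul_const τ
    have h3 := (h2.cos.sub (h2.sin.const_mul T)).const_sub 1
    simpa using h3
  rw [hasDerivAt_iff_tendsto_slope_zero] at h1
  have h2 : Tendsto ε l (nhdsWithin 0 {0}ᶜ) :=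
    tendsto_nhdsWithin_iff.2 ⟨hε0, hε.mono fun i hi => hi.ne'⟩
  refine (h1.comp h2).congr fun i => ?_
  simp [div_eq_inv_mul]

theorem tendsto_one_sub_cos_div_sq {ι : Type*} {l : Filter ι} {ε : ι → ℝ}
    (hε : ∀ᶠ i in l, 0 < ε i) (hε0 : Tendsto ε l (nhds 0)) (τ : ℝ) :
    Tendsto (fun i => (1 - Real.cos (ε i * τ)) / ε i ^ 2) l (nhds (τ ^ 2 / 2)) := by
  have h1 : HasDerivAt (fun x : ℝ => Real.sin (x * (τ / 2))) (τ / 2) 0 := by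
    have h2 : HasDerivAt (fun x : ℝ => x * (τ / 2)) (τ / 2) 0 := by
      simpa using (hasDerivAt_id (0 : ℝ)).mul_const (τ / 2)
    simpa using h2.sin
  rw [hasDerivAt_iff_tendsto_slope_zero] at h1
  have h2 : Tendsto ε l (nhdsWithin 0 {0}ᶜ) :=
    tendsto_nhdsWithin_iff.2 ⟨hε0, hε.mono fun i hi => hi.ne'⟩
  have h3 := ((h1.comp h2).pow 2).const_mul 2
  have h4 : 2 * (τ / 2) ^ 2 = τ ^ 2 / 2 := by ring
  rw [h4] at h3
  refine h3.congr fun i => ?_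
  have h5 : ε i * τ = 2 * (ε i * (τ / 2)) := by ring
  rw [h5, Real.cos_two_mul, Real.cos_sq']
  simp only [Function.comp, zero_add, zero_mul, Real.sin_zero, sub_zero, smul_eq_mul]
  field_simp
  ring

theorem IsGumbelTail_s1.exists_threshold_bound {H h : ℝ → ℝ} (hH : IsGumbelTail_s1 H h) {ι : Type*}
    {l : Filter ι} {s r : ι → ℝ} {A : ℝ} (hr : Tendsto r l atTop)
    (hs : Tendsto (fun i => (s i - r i) / h (r i)) l (nhds A)) :
    ∃ K, 0 ≤ K ∧ ∀ᶠ i in l, 0 < s i ∧ ∀ p, 0 ≤ p →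
      H (s i * (1 + 2 * p * (h (r i) / r i))) ≤ H (r i) * (K / (1 + p ^ 2)) := by
  set C := |A| + 1 with hC
  have hC0 : 0 < C := by positivity
  obtain ⟨K, hK, hK'⟩ := hH.exists_eventually_forall_le hC0.le
  refine ⟨K, hK, ?_⟩
  have hA : -C < A := by have := neg_abs_le A; linarith
  have h1 := (hH.tendsto_aux_div_id.comp hr).eventually (gt_mem_nhds (by positivity : 0 < 1 / (2 * C)))
  filter_upwards [hr.eventually hK', h1, hs.eventually (lt_mem_nhds hA),
    hr.eventually_gt_atTop 0] with i h2 h3 h4 h5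
  have hh := hH.aux_pos (r i)
  rw [lt_div_iff₀ hh] at h4
  simp only [Function.comp] at h3
  rw [div_lt_div_iff₀ h5 (by positivity)] at h3
  have h6 : r i / 2 ≤ s i := by nlinarith
  refine ⟨by linarith, fun p hp => ?_⟩
  have h7 : r i + (p - C) * h (r i) ≤ s i * (1 + 2 * p * (h (r i) / r i)) := by
    have h8 : r i / 2 * (2 * p * (h (r i) / r i)) = p * h (r i) := by field_simp
    have h9 : r i / 2 * (2 * p * (h (r i) / r i)) ≤ s i * (2 * p * (h (r i) / r i)) := by gcongr
    linarith
  calc _ ≤ H (r i + (p - C) * h (r i)) := hH.anti h7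
    _ ≤ _ := h2 p hp
    _ = _ := by ring

section Polar

variable {Ω : Type*} [MeasurableSpace Ω] {μ : Measure Ω} [IsProbabilityMeasure μ] {R : Ω → ℝ}
  {h : ℝ → ℝ} {ι : Type*} {l : Filter ι} [l.IsCountablyGenerated]

theorem tendsto_marginal_tail (hR : Measurable R) (hRpos : ∀ᵐ ω ∂μ, 0 < R ω)
    (hH : IsGumbelTail_s1 (fun t => μ.real {ω | t < R ω}) h) {s r : ι → ℝ} {A : ℝ}
    (hr : Tendsto r l atTop) (hs : Tendsto (fun i => (s i - r i) / h (r i)) l (nhds A)) :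
    Tendsto (fun i => (∫ φ in (0 : ℝ)..2 * π, μ.real {ω | s i < R ω * Real.cos φ}) /
      (√(h (r i) / r i) * μ.real {ω | r i < R ω})) l (nhds (Real.exp (-A) * √(2 * π))) := by
  have hint : ∫ τ : ℝ, Real.exp (-(A + τ ^ 2 / 2)) = Real.exp (-A) * √(2 * π) := by
    have h1 := integral_gaussian (1 / 2)
    rw [div_div_eq_mul_div, div_one, mul_comm π] at h1
    rw [← h1, ← integral_const_mul]
    congr 1 with τ
    rw [← Real.exp_add]
    congr 1
    ring
  rw [← hint]
  obtain ⟨K, hK, hK'⟩ := hH.exists_threshold_bound hr hs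
  have hr0 := hr.eventually_gt_atTop 0
  have hq := hH.tendsto_aux_div_id.comp hr
  have hε : ∀ᶠ i in l, 0 < √(h (r i) / r i) := by
    filter_upwards [hr0] with i hi
    exact Real.sqrt_pos.2 (div_pos (hH.aux_pos _) hi)
  have hε0 : Tendsto (fun i => √(h (r i) / r i)) l (nhds 0) := by
    simpa [Function.comp_def] using (Real.continuous_sqrt.tendsto 0).comp hq
  refine tendsto_intervalIntegral_period_div (c := 0)
    (bound := fun τ => 2 * K * (1 + (π⁻¹ * τ) ^ 2)⁻¹) ?_ ?_ hε hε0 (fun i => hH.pos _)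
    (fun i φ => measureReal_nonneg) ?_ ?_ ?_ ?_
  · intro i
    exact measurable_measureReal_angle hR (D := {p | s i < p.1 * p.2.1})
      (measurableSet_lt (by fun_prop) (by fun_prop))
  · intro i φ
    simp only [Real.cos_add_two_pi]
  · filter_upwards [hK', hr0] with i h1 h2 τ hτ
    have h3 : 0 < h (r i) / r i := div_pos (hH.aux_pos _) h2
    have h4 : 2 / π ^ 2 * (√(h (r i) / r i) * τ) ^ 2 = 2 * (π⁻¹ * τ) ^ 2 * (h (r i) / r i) := by
      rw [mul_pow, Real.sq_sqrt h3.le]; field_simp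
    rw [zero_add]
    refine (measureReal_lt_mul_le hRpos h1.1 (q := 2 * (π⁻¹ * τ) ^ 2 * (h (r i) / r i))
      (by positivity) fun _ => ?_).trans ((h1.2 _ (sq_nonneg _)).trans ?_)
    · rw [← h4]
      exact Real.cos_le_one_sub_mul_cos_sq hτ
    · gcongr
      rw [← div_eq_mul_inv, div_le_div_iff₀ (by positivity) (by positivity)]
      have : 0 ≤ 1 - 2 * (π⁻¹ * τ) ^ 2 + 2 * ((π⁻¹ * τ) ^ 2) ^ 2 + 0 := by
        nlinarith [sq_nonneg ((π⁻¹ * τ) ^ 2 - 1), sq_nonneg ((π⁻¹ * τ) ^ 2)]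
      nlinarith [sq_nonneg ((π⁻¹ * τ) ^ 2)]
  · exact (integrable_inv_one_add_sq.comp_mul_left' (inv_ne_zero Real.pi_ne_zero)).const_mul _
  · intro τ; positivity
  · intro τ
    have hk : Tendsto (fun i => Real.cos (√(h (r i) / r i) * τ)) l (nhds 1) := by
      have := (Real.continuous_cos.tendsto 0).comp (by simpa using hε0.mul_const τ)
      simpa [Function.comp_def] using this
    have hL := tendsto_one_sub_cos_div_sq hε hε0 τ
    have hL' : Tendsto (fun i => (1 - Real.cos (√(h (r i) / r i) * τ)) / (h (r i) / r i)) l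
        (nhds (τ ^ 2 / 2)) := by
      refine hL.congr' ?_
      filter_upwards [hr0] with i hi
      rw [Real.sq_sqrt (div_pos (hH.aux_pos _) hi).le]
    refine (hH.tendsto_comp hr
      (tendsto_threshold_div (fun i => hH.aux_pos (r i)) hs hk hL')).congr' ?_
    filter_upwards [hk.eventually (lt_mem_nhds one_pos)] with i hi
    rw [zero_add, measureReal_lt_mul_eq hi, div_mul_cancel₀ _ (hH.aux_pos _).ne',
      add_sub_cancel]

theorem integral_exp_neg_max {T : ℝ} (hT : 0 < T) (A B : ℝ) :
    ∫ τ : ℝ, Real.exp (-max (A + T * τ) (B + -T * τ)) = Real.exp (-((A + B) / 2)) * (2 / T) := by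
  have h1 := integral_add_right_eq_self (μ := volume)
    (fun τ : ℝ => Real.exp (-max (A + T * τ) (B + -T * τ))) ((B - A) / (2 * T))
  have h2 : ∀ τ : ℝ, Real.exp (-max (A + T * (τ + (B - A) / (2 * T)))
      (B + -T * (τ + (B - A) / (2 * T)))) = Real.exp (-((A + B) / 2)) * Real.exp (-T * |τ|) := by
    intro τ
    have h3 : A + T * (τ + (B - A) / (2 * T)) = (A + B) / 2 + T * τ := by field_simp; ring
    have h4 : B + -T * (τ + (B - A) / (2 * T)) = (A + B) / 2 + T * -τ := by field_simp; ring
    rw [h3, h4, max_add_add_left, ← mul_max_of_nonneg _ _ hT.le, ← Real.exp_add,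
      ← abs_eq_max_neg]
    congr 1
    ring
  rw [← h1]
  simp only [h2]
  rw [integral_const_mul, integral_comp_abs (f := fun x => Real.exp (-T * x)),
    integral_exp_mul_Ioi (by linarith)]
  simp [div_eq_mul_inv]

theorem tendsto_joint_tail (hR : Measurable R) (hRpos : ∀ᵐ ω ∂μ, 0 < R ω)
    (hH : IsGumbelTail_s1 (fun t => μ.real {ω | t < R ω}) h) {β : ℝ} (hβ : β ∈ Set.Ioo 0 (π / 2))
    {s s' r : ι → ℝ} {A B : ℝ} (hr : Tendsto r l atTop)
    (hs : Tendsto (fun i => (s i / Real.cos β - r i) / h (r i)) l (nhds A))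
    (hs' : Tendsto (fun i => (s' i / Real.cos β - r i) / h (r i)) l (nhds B)) :
    Tendsto (fun i => (∫ φ in (0 : ℝ)..2 * π,
        μ.real {ω | s i < R ω * Real.cos φ ∧ s' i < R ω * Real.cos (φ - 2 * β)}) /
      (h (r i) / r i * μ.real {ω | r i < R ω})) l
      (nhds (Real.exp (-((A + B) / 2)) * (2 / Real.tan β))) := by
  have hcos : 0 < Real.cos β := Real.cos_pos_of_mem_Ioo ⟨by linarith [hβ.1, Real.pi_pos], hβ.2⟩
  have hT : 0 < Real.tan β := Real.tan_pos_of_pos_of_lt_pi_div_two hβ.1 hβ.2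
  set T := Real.tan β with hTdef
  have hsin : Real.sin β = T * Real.cos β := (Real.tan_mul_cos hcos.ne').symm
  rw [← integral_exp_neg_max hT]
  obtain ⟨K, hK, hK'⟩ := hH.exists_threshold_bound hr hs
  obtain ⟨L, hL, hL'⟩ := hH.exists_threshold_bound hr hs'
  have hr0 := hr.eventually_gt_atTop 0
  have hε0 := hH.tendsto_aux_div_id.comp hr
  have hε : ∀ᶠ i in l, 0 < h (r i) / r i := by
    filter_upwards [hr0] with i hi
    exact div_pos (hH.aux_pos _) hi
  have hev : ∀ (i : ι) (δ : ℝ),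
      {ω | s i < R ω * Real.cos (β + δ) ∧ s' i < R ω * Real.cos (β + δ - 2 * β)} =
      {ω | s i / Real.cos β < R ω * (Real.cos δ - T * Real.sin δ) ∧
        s' i / Real.cos β < R ω * (Real.cos δ - -T * Real.sin δ)} := by
    intro i δ
    have h1 : Real.cos (β + δ) = (Real.cos δ - T * Real.sin δ) * Real.cos β := by
      rw [Real.cos_add, hsin]; ring
    have h2 : Real.cos (β + δ - 2 * β) = (Real.cos δ - -T * Real.sin δ) * Real.cos β := by
      rw [show β + δ - 2 * β = δ - β by ring, Real.cos_sub, hsin]; ring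
    ext ω
    rw [Set.mem_ofPred_eq, Set.mem_ofPred_eq, div_lt_iff₀ hcos, div_lt_iff₀ hcos, h1, h2,
      mul_assoc, mul_assoc]
  have hgeom : ∀ δ, 0 ≤ δ → δ ≤ π → 0 < Real.cos δ - T * Real.sin δ →
      Real.cos δ - T * Real.sin δ ≤ 1 - T * δ / 2 := by
    intro δ h0 h1 h2
    have hs0 : 0 ≤ Real.sin δ := Real.sin_nonneg_of_nonneg_of_le_pi h0 h1
    have h3 : δ ≤ π / 2 := by
      by_contra! hcon
      have := Real.cos_nonpos_of_pi_div_two_le_of_le hcon.le (by linarith [Real.pi_pos])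
      nlinarith
    have h4 := Real.mul_le_sin h0 h3
    have h5 : 1 / 2 * δ ≤ 2 / π * δ := by
      gcongr ?_ * δ
      rw [div_le_div_iff₀ (by norm_num) Real.pi_pos]
      linarith [Real.pi_le_four]
    have h6 : T * (1 / 2 * δ) ≤ T * Real.sin δ := by gcongr; linarith
    linarith [Real.cos_le_one δ]
  refine tendsto_intervalIntegral_period_div (c := β)
    (bound := fun τ => (K + L) * (1 + (T / 4 * τ) ^ 2)⁻¹) ?_ ?_ hε hε0 (fun i => hH.pos _)
    (fun i φ => measureReal_nonneg) ?_ ?_ ?_ ?_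
  · intro i
    simp only [Real.cos_sub]
    exact measurable_measureReal_angle (μ := μ) hR (D := {p | s i < p.1 * p.2.1} ∩
      {p | s' i < p.1 * (p.2.1 * Real.cos (2 * β) + p.2.2 * Real.sin (2 * β))})
      ((measurableSet_lt (by fun_prop) (by fun_prop)).inter
        (measurableSet_lt (by fun_prop) (by fun_prop)))
  · intro i φ
    simp only [add_sub_right_comm, Real.cos_add_two_pi]
  · filter_upwards [hK', hL', hε] with i h1 h2 h3 τ hτ
    rw [hev]
    have h4 : ∀ p : ℝ, p ^ 2 = (T / 4 * τ) ^ 2 → ∀ M, M ≤ K + L →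
        M / (1 + p ^ 2) ≤ (K + L) * (1 + (T / 4 * τ) ^ 2)⁻¹ := by
      intro p hp M hM
      rw [hp, div_eq_mul_inv]
      gcongr
    rw [abs_le] at hτ
    rcases le_total 0 τ with h0 | h0
    · have hp : 0 ≤ T / 4 * τ := by positivity
      refine (measureReal_mono fun ω hω => hω.1).trans ((measureReal_lt_mul_le hRpos h1.1
        (q := 2 * (T / 4 * τ) * (h (r i) / r i)) (by positivity) fun hpos => ?_).trans
        ((h1.2 _ hp).trans ?_))
      · have := hgeom (h (r i) / r i * τ) (by positivity) hτ.2 hpos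
        linarith
      · have := h4 _ rfl K (by linarith)
        gcongr
    · have hp : 0 ≤ T / 4 * -τ := mul_nonneg (by positivity) (by linarith)
      refine (measureReal_mono fun ω hω => hω.2).trans ((measureReal_lt_mul_le hRpos h2.1
        (q := 2 * (T / 4 * -τ) * (h (r i) / r i)) (by positivity) fun hpos => ?_).trans
        ((h2.2 _ hp).trans ?_))
      · have := hgeom (-(h (r i) / r i * τ)) (by nlinarith) (by linarith)
          (by rw [Real.cos_neg, Real.sin_neg]; linarith)
        rw [Real.cos_neg, Real.sin_neg] at this
        linarith
      · have := h4 (T / 4 * -τ) (by ring) L (by linarith)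
        gcongr
  · exact (integrable_inv_one_add_sq.comp_mul_left' (by positivity)).const_mul _
  · intro τ; positivity
  · intro τ
    have hk : ∀ T' : ℝ, Tendsto (fun i => Real.cos (h (r i) / r i * τ) -
        T' * Real.sin (h (r i) / r i * τ)) l (nhds 1) := by
      intro T'
      have hc : Continuous fun x : ℝ => Real.cos (x * τ) - T' * Real.sin (x * τ) := by fun_prop
      simpa [Function.comp_def] using (hc.tendsto 0).comp hε0
    have hV := tendsto_threshold_div (fun i => hH.aux_pos (r i)) hs (hk T)
      (tendsto_one_sub_cos_sub_div hε hε0 T τ)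
    have hV' := tendsto_threshold_div (fun i => hH.aux_pos (r i)) hs' (hk (-T))
      (tendsto_one_sub_cos_sub_div hε hε0 (-T) τ)
    refine (hH.tendsto_comp hr (hV.max hV')).congr' ?_
    filter_upwards [(hk T).eventually (lt_mem_nhds one_pos),
      (hk (-T)).eventually (lt_mem_nhds one_pos)] with i h1 h2
    have hh := hH.aux_pos (r i)
    rw [hev, max_mul_of_nonneg _ _ hh.le, ← max_add_add_left, div_mul_cancel₀ _ hh.ne',
      div_mul_cancel₀ _ hh.ne', add_sub_cancel, add_sub_cancel]
    simp only [max_lt_iff, div_lt_iff₀ h1, div_lt_iff₀ h2]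

end Polar

/-- An antitone tail satisfying the Gumbel limit admits an asymptotic tail quantile function. -/
theorem exists_tendsto_mul_tail {T h : ℝ → ℝ} (hanti : Antitone T) (hpos : ∀ t, 0 < T t)
    (hzero : Tendsto T atTop (nhds 0)) (hh : ∀ t, 0 < h t)
    (hG : ∀ y : ℝ, Tendsto (fun t => T (t + y * h t) / T t) atTop (nhds (Real.exp (-y)))) :
    ∃ c : ℝ → ℝ, Tendsto c atTop atTop ∧
      ∀ y : ℝ, Tendsto (fun u => u * T (c u + y * h (c u))) atTop (nhds (Real.exp (-y))) := by
  set c : ℝ → ℝ := fun u => sInf {t | T t < 1 / u} with hc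
  have hne : ∀ u, 0 < u → {t | T t < 1 / u}.Nonempty := fun u hu =>
    (hzero.eventually (gt_mem_nhds (one_div_pos.2 hu))).exists
  have hlb : ∀ M, ∀ᶠ u in atTop, ∀ t ∈ {t | T t < 1 / u}, M ≤ t := by
    intro M
    filter_upwards [eventually_gt_atTop (1 / T M)] with u hu t (ht : T t < 1 / u)
    by_contra! hcon
    have h1 := hanti hcon.le
    have h2 : 0 < u := lt_trans (one_div_pos.2 (hpos M)) hu
    have h3 : 1 / u < T M := by
      rw [div_lt_iff₀ (hpos M)] at hu
      rw [div_lt_iff₀ h2]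
      linarith
    linarith
  have hctop : Tendsto c atTop atTop := by
    refine tendsto_atTop.2 fun M => ?_
    filter_upwards [hlb M, eventually_gt_atTop 0] with u h1 h2
    exact le_csInf (hne u h2) h1
  have hright : ∀ᶠ u in atTop, ∀ t, c u < t → T t < 1 / u := by
    filter_upwards [eventually_gt_atTop 0] with u h2 t ht
    obtain ⟨s, hs, hst⟩ := exists_lt_of_csInf_lt (hne u h2) ht
    exact (hanti hst.le).trans_lt hs
  have hleft : ∀ᶠ u in atTop, ∀ t, t < c u → 1 / u ≤ T t := by
    filter_upwards [hlb 0] with u h1 t ht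
    exact not_lt.1 fun h2 => notMem_of_lt_csInf ht ⟨0, h1⟩ h2
  have hinv : ∀ y : ℝ, Tendsto (fun u => T (c u) / T (c u + y * h (c u))) atTop
      (nhds (Real.exp y)) := by
    intro y
    have h1 := ((hG y).comp hctop).inv₀ (Real.exp_pos _).ne'
    rw [← Real.exp_neg, neg_neg] at h1
    simpa [Function.comp_def] using h1
  have hone : Tendsto (fun u => u * T (c u)) atTop (nhds 1) := by
    have hexp : Tendsto Real.exp (nhds 0) (nhds 1) := by
      simpa using Real.continuous_exp.tendsto 0
    rw [tendsto_order]
    constructor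
    · intro m hm
      have h1 : ∀ᶠ x in nhdsWithin (0 : ℝ) (Set.Iio 0), m < Real.exp x :=
        nhdsWithin_le_nhds (hexp.eventually (lt_mem_nhds hm))
      obtain ⟨y, hy, hy'⟩ := (h1.and self_mem_nhdsWithin).exists
      filter_upwards [hleft, (hinv y).eventually (lt_mem_nhds hy), eventually_gt_atTop 0]
        with u h2 h3 h4
      refine h3.trans_le ?_
      have h5 := h2 (c u + y * h (c u)) (by
        have := mul_neg_of_neg_of_pos hy' (hh (c u)); linarith)
      rw [div_le_iff₀ h4] at h5
      rw [div_le_iff₀ (hpos _)]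
      nlinarith [hpos (c u)]
    · intro m hm
      have h1 : ∀ᶠ x in nhdsWithin (0 : ℝ) (Set.Ioi 0), Real.exp x < m :=
        nhdsWithin_le_nhds (hexp.eventually (gt_mem_nhds hm))
      obtain ⟨y, hy, hy'⟩ := (h1.and self_mem_nhdsWithin).exists
      filter_upwards [hright, (hinv y).eventually (gt_mem_nhds hy), eventually_gt_atTop 0]
        with u h2 h3 h4
      refine lt_of_le_of_lt ?_ h3
      have h5 := h2 (c u + y * h (c u)) (by
        have := mul_pos hy' (hh (c u)); linarith)
      rw [lt_div_iff₀ h4] at h5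
      rw [le_div_iff₀ (hpos _)]
      nlinarith [hpos (c u)]
  refine ⟨c, hctop, fun y => ?_⟩
  have h1 := hone.mul ((hG y).comp hctop)
  rw [one_mul] at h1
  refine h1.congr fun u => ?_
  have := hpos (c u)
  simp only [Function.comp]
  field_simp

theorem tendsto_of_exp_sandwich {ι : Type*} {l : Filter ι} {f : ι → ℝ} {a κ : ℝ}
    {lo up : ℝ → ι → ℝ}
    (hlo : ∀ e > 0, ∀ᶠ i in l, lo e i ≤ f i) (hup : ∀ e > 0, ∀ᶠ i in l, f i ≤ up e i)
    (hlo' : ∀ e, Tendsto (lo e) l (nhds (Real.exp (-(κ * e)) * a)))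
    (hup' : ∀ e, Tendsto (up e) l (nhds (Real.exp (κ * e) * a))) :
    Tendsto f l (nhds a) := by
  rw [tendsto_order]
  constructor
  · intro m hm
    have hc : Tendsto (fun e : ℝ => Real.exp (-(κ * e)) * a) (nhds 0) (nhds a) := by
      have : Continuous fun e : ℝ => Real.exp (-(κ * e)) * a := by fun_prop
      simpa using this.tendsto 0
    have h1 : ∀ᶠ e in nhdsWithin (0 : ℝ) (Set.Ioi 0), m < Real.exp (-(κ * e)) * a :=
      nhdsWithin_le_nhds (hc.eventually (lt_mem_nhds hm))
    obtain ⟨e, he, he'⟩ := (h1.and self_mem_nhdsWithin).exists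
    filter_upwards [hlo e he', (hlo' e).eventually (lt_mem_nhds he)] with i h2 h3
    exact h3.trans_le h2
  · intro m hm
    have hc : Tendsto (fun e : ℝ => Real.exp (κ * e) * a) (nhds 0) (nhds a) := by
      have : Continuous fun e : ℝ => Real.exp (κ * e) * a := by fun_prop
      simpa using this.tendsto 0
    have h1 : ∀ᶠ e in nhdsWithin (0 : ℝ) (Set.Ioi 0), Real.exp (κ * e) * a < m :=
      nhdsWithin_le_nhds (hc.eventually (gt_mem_nhds hm))
    obtain ⟨e, he, he'⟩ := (h1.and self_mem_nhdsWithin).exists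
    filter_upwards [hup e he', (hup' e).eventually (gt_mem_nhds he)] with i h2 h3
    exact h2.trans_lt h3

theorem measureReal_lt_eq_one_sub {Ω : Type*} [MeasurableSpace Ω] {μ : Measure Ω}
    [IsProbabilityMeasure μ] {X : Ω → ℝ} (hX : Measurable X) (t : ℝ) :
    μ.real {ω | t < X ω} = 1 - (μ {ω | X ω ≤ t}).toReal := by
  rw [← measureReal_def, ← probReal_compl_eq_one_sub (measurableSet_le hX measurable_const)]
  congr 1 with ω
  simp

theorem tendsto_measureReal_lt_atTop {Ω : Type*} [MeasurableSpace Ω] {μ : Measure Ω}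
    [IsProbabilityMeasure μ] {X : Ω → ℝ} (hX : Measurable X) :
    Tendsto (fun t => μ.real {ω | t < X ω}) atTop (nhds 0) := by
  have : IsProbabilityMeasure (Measure.map X μ) := Measure.isProbabilityMeasure_map hX.aemeasurable
  have h1 := (tendsto_cdf_atTop (Measure.map X μ)).const_sub 1
  rw [sub_self] at h1
  refine h1.congr fun t => ?_
  rw [cdf_eq_real, measureReal_lt_eq_one_sub hX, measureReal_def,
    Measure.map_apply hX measurableSet_Iic]
  rfl

theorem eta_eq_rpow {ρ θ : ℝ} (hρ : ρ ∈ Set.Ioo (-1 : ℝ) 1) :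
    ((1 + ρ) / 2) ^ (θ / 2) = √(2 / (1 + ρ)) ^ (-θ) := by
  have h1 : 0 < 1 + ρ := by linarith [hρ.1]
  rw [Real.sqrt_eq_rpow, ← Real.rpow_mul (by positivity), ← inv_div, Real.inv_rpow (by positivity),
    ← Real.rpow_neg (by positivity)]
  congr 1
  ring

/-- If `F` is in the Gumbel max-domain of attraction with scaling function `w` satisfying
`w(cu)/w(u) → c^(θ-1)` for all `c > 0` (some `θ ∈ [0,∞)`), then for all `x,y > 0`,
`S_u(x,y) → (xy)^(1/(2η))` where `η = ((1+ρ)/2)^(θ/2) = α_ρ^(-θ) ∈ (0,1]`. -/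
theorem residual_dependence_index_of_elliptical
    {Ω : Type*} [MeasurableSpace Ω] (μ : Measure Ω) [IsProbabilityMeasure μ]
    (R U₁ U₂ : Ω → ℝ) (ρ : ℝ) (hρ : ρ ∈ Set.Ioo (-1 : ℝ) 1)
    (hRmeas : Measurable R) (hUmeas : Measurable fun ω => (U₁ ω, U₂ ω))
    (hIndep : IndepFun R (fun ω => (U₁ ω, U₂ ω)) μ)
    (hUnif : Measure.map (fun ω => (U₁ ω, U₂ ω)) μ = uniformCircle)
    (X₁ X₂ : Ω → ℝ)
    (hX₁ : X₁ = fun ω => R ω * U₁ ω)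
    (hX₂ : X₂ = fun ω => R ω * (ρ * U₁ ω + Real.sqrt (1 - ρ ^ 2) * U₂ ω))
    -- `F` is the distribution function of the positive random radius `R`
    (F : ℝ → ℝ) (hF : F = fun t => (μ {ω | R ω ≤ t}).toReal)
    (hF0 : F 0 = 0) (hFlt : ∀ x > (0 : ℝ), F x < 1)
    -- `Q` is the distribution function of `X₁`
    (Q : ℝ → ℝ) (hQ : Q = fun t => (μ {ω | X₁ ω ≤ t}).toReal)
    -- `F` is in the Gumbel max-domain of attraction with positive scaling function `w`
    (w : ℝ → ℝ) (hw : ∀ u, 0 < w u)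
    (hGumbel : ∀ x : ℝ,
      Tendsto (fun u => (1 - F (u + x / w u)) / (1 - F u)) atTop (nhds (Real.exp (-x))))
    -- the joint survival function `S̃_u(x,y)`
    (Stilde : ℝ → ℝ → ℝ → ℝ)
    (hStilde : ∀ u x y,
      Stilde u x y = (μ {ω | 1 - x / u < Q (X₁ ω) ∧ 1 - y / u < Q (X₂ ω)}).toReal)
    (αρ : ℝ) (hαρ : αρ = Real.sqrt (2 / (1 + ρ)))
    -- condition (2.7): `w` is regularly varying with index `θ - 1`, `θ ∈ [0,∞)`
    (θ : ℝ) (hθ : 0 ≤ θ)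
    (hwrv : ∀ c > (0 : ℝ), Tendsto (fun u => w (c * u) / w u) atTop (nhds (c ^ (θ - 1))))
    (η : ℝ) (hη : η = ((1 + ρ) / 2) ^ (θ / 2)) :
    η = αρ ^ (-θ) ∧ η ∈ Set.Ioc (0 : ℝ) 1 ∧
    ∀ x y : ℝ, 0 < x → 0 < y →
      Tendsto (fun u => Stilde u x y / Stilde u 1 1) atTop
        (nhds ((x * y) ^ (1 / (2 * η)))) := by
  subst hX₁ hX₂ hF hQ hαρ hη
  have hρ1 : 0 < 1 + ρ := by linarith [hρ.1]
  have hα0 : 0 < √(2 / (1 + ρ)) := Real.sqrt_pos.2 (by positivity)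
  have hηα := eta_eq_rpow (θ := θ) hρ
  refine ⟨hηα, ⟨by positivity, Real.rpow_le_one (by positivity) (by linarith [hρ.2])
    (by positivity)⟩, ?_⟩
  intro x y hx hy
  set α := √(2 / (1 + ρ)) with hα
  set κ := α ^ θ with hκ
  have hκη : (1 : ℝ) / (2 * ((1 + ρ) / 2) ^ (θ / 2)) = κ / 2 := by
    rw [hηα, Real.rpow_neg hα0.le, ← hκ]
    field_simp
  rw [hκη]
  -- the angle between the two coordinate directions is `2 * β`
  set β := Real.arccos ρ / 2 with hβdef
  have h2β : 2 * β = Real.arccos ρ := by rw [hβdef]; ring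
  have hβ : β ∈ Set.Ioo 0 (π / 2) := by
    have h1 := Real.arccos_pos.2 hρ.2
    have h2 : Real.arccos ρ < π := by
      refine lt_of_le_of_ne (Real.arccos_le_pi ρ) fun h => ?_
      rw [Real.arccos_eq_pi] at h
      linarith [hρ.1]
    exact ⟨by linarith, by linarith⟩
  have hcosβ : 0 < Real.cos β := Real.cos_pos_of_mem_Ioo ⟨by linarith [hβ.1, Real.pi_pos], hβ.2⟩
  have hcos2β : Real.cos (2 * β) = ρ := by rw [h2β, Real.cos_arccos hρ.1.le hρ.2.le]
  have hsin2β : Real.sin (2 * β) = √(1 - ρ ^ 2) := by rw [h2β, Real.sin_arccos]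
  have hαβ : α = 1 / Real.cos β := by
    rw [hα, Real.sqrt_eq_iff_mul_self_eq_of_pos (by positivity)]
    have : 1 + ρ = 2 * Real.cos β ^ 2 := by rw [← hcos2β, Real.cos_two_mul]; ring
    rw [this]
    field_simp
  have hUm1 : Measurable U₁ := measurable_fst.comp hUmeas
  have hUm2 : Measurable U₂ := measurable_snd.comp hUmeas
  -- the Gumbel tail of the radius
  set h : ℝ → ℝ := fun u => 1 / w u with hh
  have hhpos : ∀ t, 0 < h t := fun t => one_div_pos.2 (hw t)
  have hHF : ∀ t, μ.real {ω | t < R ω} = 1 - (μ {ω | R ω ≤ t}).toReal :=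
    measureReal_lt_eq_one_sub hRmeas
  have hanti : ∀ X : Ω → ℝ, Antitone fun t => μ.real {ω | t < X ω} :=
    fun X a b hab => measureReal_mono fun ω (hω : b < X ω) => hab.trans_lt hω
  have hRpos : ∀ᵐ ω ∂μ, 0 < R ω := by
    have h1 : μ {ω | R ω ≤ 0} = 0 := by
      rcases (ENNReal.toReal_eq_zero_iff _).1 hF0 with h1 | h1
      · exact h1
      · exact absurd h1 (measure_ne_top _ _)
    rw [ae_iff]
    simpa using h1
  have hH0 : μ.real {ω | 0 < R ω} = 1 := by
    have : (μ {ω | R ω ≤ 0}).toReal = 0 := hF0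
    rw [hHF, this, sub_zero]
  have hH : IsGumbelTail_s1 (fun t => μ.real {ω | t < R ω}) h := by
    refine ⟨hanti R, fun t => ?_, fun t ht => ?_, tendsto_measureReal_lt_atTop hRmeas, hhpos, ?_⟩
    · rcases le_or_gt t 0 with ht | ht
      · exact (hH0 ▸ one_pos).trans_le (hanti R ht)
      · have := hFlt t ht
        rw [hHF]
        linarith
    · exact le_antisymm measureReal_le_one (hH0.symm.le.trans (hanti R ht))
    · intro x
      refine (hGumbel x).congr fun u => ?_
      simp only [hHF, hh, div_eq_mul_one_div x (w u)]
  -- polar representation of the marginal and of the joint tail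
  set T : ℝ → ℝ := fun t => μ.real {ω | t < R ω * U₁ ω} with hT
  have hTpolar : ∀ t, T t =
      (2 * π)⁻¹ * ∫ φ in (0 : ℝ)..2 * π, μ.real {ω | t < R ω * Real.cos φ} := fun t =>
    measureReal_eq_intervalIntegral_of_uniformCircle hRmeas hUmeas hIndep hUnif
      (D := {p | t < p.1 * p.2.1}) (measurableSet_lt (by fun_prop) (by fun_prop))
  set P : ℝ → ℝ → ℝ := fun s s' =>
    μ.real {ω | s < R ω * U₁ ω ∧ s' < R ω * (ρ * U₁ ω + √(1 - ρ ^ 2) * U₂ ω)} with hP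
  have hPpolar : ∀ s s', P s s' = (2 * π)⁻¹ * ∫ φ in (0 : ℝ)..2 * π,
      μ.real {ω | s < R ω * Real.cos φ ∧ s' < R ω * Real.cos (φ - 2 * β)} := by
    intro s s'
    have h1 : ∀ φ, Real.cos (φ - 2 * β) = ρ * Real.cos φ + √(1 - ρ ^ 2) * Real.sin φ := by
      intro φ
      rw [Real.cos_sub, hcos2β, hsin2β]
      ring
    simp only [h1]
    exact measureReal_eq_intervalIntegral_of_uniformCircle hRmeas hUmeas hIndep hUnif
      (D := {p | s < p.1 * p.2.1} ∩ {p | s' < p.1 * (ρ * p.2.1 + √(1 - ρ ^ 2) * p.2.2)})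
      ((measurableSet_lt (by fun_prop) (by fun_prop)).inter
        (measurableSet_lt (by fun_prop) (by fun_prop)))
  have hpi : (0 : ℝ) < 2 * π := by positivity
  -- the marginal tail satisfies the Gumbel limit
  have hTlim : ∀ a : ℝ, Tendsto (fun t => T (t + a * h t) /
      (√(h t / t) * μ.real {ω | t < R ω})) atTop
      (nhds ((2 * π)⁻¹ * (Real.exp (-a) * √(2 * π)))) := by
    intro a
    have h1 : Tendsto (fun t => (t + a * h t - t) / h t) atTop (nhds a) := by
      refine tendsto_const_nhds.congr fun t => ?_
      have := (hhpos t).ne'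
      field_simp
      ring
    refine ((tendsto_marginal_tail hRmeas hRpos hH tendsto_id h1).const_mul (2 * π)⁻¹).congr
      fun t => ?_
    rw [hTpolar, mul_div_assoc]
    rfl
  have hTpos : ∀ t, 0 < T t := by
    intro t
    have h1 := (hTlim 0).eventually (lt_mem_nhds (by positivity))
    obtain ⟨s, h2, h3, h4⟩ :=
      (h1.and ((eventually_ge_atTop t).and (eventually_gt_atTop 0))).exists
    rw [zero_mul, add_zero] at h2
    have h5 : 0 < √(h s / s) * μ.real {ω | s < R ω} :=
      mul_pos (Real.sqrt_pos.2 (div_pos (hhpos s) h4)) (hH.pos s)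
    exact ((div_pos_iff_of_pos_right h5).1 h2).trans_le (hanti _ h3)
  have hTG : ∀ a : ℝ, Tendsto (fun t => T (t + a * h t) / T t) atTop
      (nhds (Real.exp (-a))) := by
    intro a
    have h1 := (hTlim a).div (hTlim 0) (by positivity)
    have h2 : (2 * π)⁻¹ * (Real.exp (-a) * √(2 * π)) /
        ((2 * π)⁻¹ * (Real.exp (-0) * √(2 * π))) = Real.exp (-a) := by
      rw [neg_zero, Real.exp_zero]
      field_simp
    rw [h2] at h1
    refine h1.congr' ?_
    filter_upwards [eventually_gt_atTop 0] with t ht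
    have h5 : 0 < √(h t / t) * μ.real {ω | t < R ω} :=
      mul_pos (Real.sqrt_pos.2 (div_pos (hhpos t) ht)) (hH.pos t)
    simp only [Pi.div_apply, zero_mul, add_zero]
    rw [div_div_div_cancel_right₀ h5.ne']
  obtain ⟨c, hctop, hc⟩ := exists_tendsto_mul_tail (hanti _) hTpos
    (tendsto_measureReal_lt_atTop (hRmeas.mul hUm1)) hhpos hTG
  -- the joint tail at levels close to the quantile
  have hrtop : Tendsto (fun u => α * c u) atTop atTop := hctop.const_mul_atTop hα0
  set D : ℝ → ℝ := fun u => h (α * c u) / (α * c u) * μ.real {ω | α * c u < R ω} with hD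
  set G : ℝ := (2 * π)⁻¹ * (2 / Real.tan β) with hG
  have hGpos : 0 < G := by
    have := Real.tan_pos_of_pos_of_lt_pi_div_two hβ.1 hβ.2
    positivity
  have hlevel : ∀ a : ℝ, Tendsto (fun u => ((c u + a * h (c u)) / Real.cos β - α * c u) /
      h (α * c u)) atTop (nhds (a * κ)) := by
    intro a
    have h1 := ((hwrv α hα0).comp hctop).const_mul (a * α)
    have h2 : a * α * α ^ (θ - 1) = a * κ := by
      rw [hκ, Real.rpow_sub_one hα0.ne']
      field_simp
    rw [h2] at h1
    refine h1.congr fun u => ?_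
    have h3 := (hw (c u)).ne'
    have h4 := (hw (α * c u)).ne'
    simp only [Function.comp, hh]
    rw [div_eq_mul_one_div _ (Real.cos β), ← hαβ]
    field_simp
    ring
  have hPlim : ∀ a b : ℝ, Tendsto (fun u => P (c u + a * h (c u)) (c u + b * h (c u)) / D u)
      atTop (nhds (Real.exp (-((a + b) * (κ / 2))) * G)) := by
    intro a b
    have h1 := (tendsto_joint_tail hRmeas hRpos hH hβ hrtop (hlevel a) (hlevel b)).const_mul
      (2 * π)⁻¹
    have h2 : (2 * π)⁻¹ * (Real.exp (-((a * κ + b * κ) / 2)) * (2 / Real.tan β)) =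
        Real.exp (-((a + b) * (κ / 2))) * G := by
      rw [hG, show (a * κ + b * κ) / 2 = (a + b) * (κ / 2) by ring]
      ring
    rw [h2] at h1
    refine h1.congr fun u => ?_
    rw [hPpolar, mul_div_assoc]
  have hDpos : ∀ᶠ u in atTop, 0 < D u := by
    filter_upwards [hrtop.eventually_gt_atTop 0] with u hu
    exact mul_pos (div_pos (hhpos _) hu) (hH.pos _)
  -- the quantile transform is sandwiched between thresholds
  have hQT : ∀ t, (μ {ω | R ω * U₁ ω ≤ t}).toReal = 1 - T t := fun t => by
    have := measureReal_lt_eq_one_sub (μ := μ) (hRmeas.mul hUm1) t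
    simp only [hT]
    simp only [Pi.mul_apply] at this
    linarith
  have hlow : ∀ z > (0 : ℝ), ∀ e > (0 : ℝ), ∀ᶠ u in atTop, ∀ t,
      c u + (-Real.log z + e) * h (c u) < t → 1 - z / u < (μ {ω | R ω * U₁ ω ≤ t}).toReal := by
    intro z hz e he
    have h1 : Real.exp (-(-Real.log z + e)) < z := by
      conv_rhs => rw [← Real.exp_log hz]
      exact Real.exp_lt_exp.2 (by linarith)
    filter_upwards [(hc (-Real.log z + e)).eventually (gt_mem_nhds h1), eventually_gt_atTop 0]
      with u h2 h3 t ht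
    rw [hQT]
    have h4 : T t ≤ T (c u + (-Real.log z + e) * h (c u)) := hanti _ ht.le
    have h5 : T (c u + (-Real.log z + e) * h (c u)) < z / u := by
      rw [lt_div_iff₀ h3]; linarith
    linarith
  have hupp : ∀ z > (0 : ℝ), ∀ e > (0 : ℝ), ∀ᶠ u in atTop, ∀ t,
      1 - z / u < (μ {ω | R ω * U₁ ω ≤ t}).toReal → c u + (-Real.log z - e) * h (c u) < t := by
    intro z hz e he
    have h1 : z < Real.exp (-(-Real.log z - e)) := by
      conv_lhs => rw [← Real.exp_log hz]
      exact Real.exp_lt_exp.2 (by linarith)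
    filter_upwards [(hc (-Real.log z - e)).eventually (lt_mem_nhds h1), eventually_gt_atTop 0]
      with u h2 h3 t ht
    by_contra! hcon
    rw [hQT] at ht
    have h4 : T (c u + (-Real.log z - e) * h (c u)) ≤ T t := hanti _ hcon
    have h5 : z / u < T (c u + (-Real.log z - e) * h (c u)) := by
      rw [div_lt_iff₀ h3]; linarith
    linarith
  have hS : ∀ x y : ℝ, 0 < x → 0 < y →
      Tendsto (fun u => Stilde u x y / D u) atTop (nhds ((x * y) ^ (κ / 2) * G)) := by
    intro x y hx hy
    have hxy : (x * y) ^ (κ / 2) = Real.exp ((Real.log x + Real.log y) * (κ / 2)) := by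
      rw [Real.rpow_def_of_pos (mul_pos hx hy), Real.log_mul hx.ne' hy.ne']
    refine tendsto_of_exp_sandwich (κ := κ)
      (lo := fun e u => P (c u + (-Real.log x + e) * h (c u))
        (c u + (-Real.log y + e) * h (c u)) / D u)
      (up := fun e u => P (c u + (-Real.log x - e) * h (c u))
        (c u + (-Real.log y - e) * h (c u)) / D u) ?_ ?_ ?_ ?_
    · intro e he
      filter_upwards [hlow x hx e he, hlow y hy e he, hDpos] with u h1 h2 h3
      rw [hStilde]
      exact div_le_div_of_nonneg_right
        (measureReal_mono fun ω hω => ⟨h1 _ hω.1, h2 _ hω.2⟩) h3.le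
    · intro e he
      filter_upwards [hupp x hx e he, hupp y hy e he, hDpos] with u h1 h2 h3
      rw [hStilde]
      exact div_le_div_of_nonneg_right
        (measureReal_mono fun ω hω => ⟨h1 _ hω.1, h2 _ hω.2⟩) h3.le
    · intro e
      convert hPlim (-Real.log x + e) (-Real.log y + e) using 2
      rw [hxy, ← mul_assoc, ← Real.exp_add]
      congr 2
      ring
    · intro e
      convert hPlim (-Real.log x - e) (-Real.log y - e) using 2
      rw [hxy, ← mul_assoc, ← Real.exp_add]
      congr 2
      ring
  have hratio := (hS x y hx hy).div (hS 1 1 one_pos one_pos) (by positivity)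
  rw [one_mul, Real.one_rpow, one_mul, mul_div_cancel_right₀ _ hGpos.ne'] at hratio
  refine hratio.congr' ?_
  filter_upwards [hDpos] with u hu
  simp only [Pi.div_apply]
  rw [div_div_div_cancel_right₀ hu.ne']
end

section
/- Suppose F is in the Gumbel max-domain of attraction with positive scaling function w, and that for some θ ∈ [0,∞), lim_{u→∞} w(cu)/w(u) = c^{θ−1} for every c > 0. Then the function u ↦ S̃_u(1,1) is regularly varying at infinity with index −1/η, where η := ((1+ρ)/2)^{θ/2}; that is, for every c > 0, lim_{u→∞} S̃_{cu}(1,1)/S̃_u(1,1) = c^{−1/η}. -/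
open MeasureTheory ProbabilityTheory Filter Real

section GumbelTail

open Set Topology

/-- `f` is a positive tail function in the Gumbel max-domain of attraction with scaling
function `w`. -/
structure IsGumbelTail_s2 (f w : ℝ → ℝ) : Prop where
  anti : Antitone f
  pos : ∀ t, 0 < f t
  tendsto_zero : Tendsto f atTop (𝓝 0)
  scale_pos : ∀ u, 0 < w u
  tendsto_ratio : ∀ x : ℝ, Tendsto (fun u => f (u + x / w u) / f u) atTop (𝓝 (exp (-x)))

/-- For an antitone function, the pointwise Gumbel limit near `t` holds jointly in the argument. -/
lemma tendsto_ratio_prod {f w : ℝ → ℝ} (hf : Antitone f) (hpos : ∀ t, 0 < f t)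
    (hw : ∀ u, 0 < w u) {t : ℝ}
    (h : ∀ᶠ x in 𝓝 t, Tendsto (fun u => f (u + x / w u) / f u) atTop (𝓝 (exp (-x)))) :
    Tendsto (fun p : ℝ × ℝ => f (p.1 + p.2 / w p.1) / f p.1) (atTop ×ˢ 𝓝 t)
      (𝓝 (exp (-t))) := by
  have hc : ContinuousAt (fun x : ℝ => exp (-x)) t := by fun_prop
  have mono : ∀ u x y, x ≤ y → f (u + y / w u) / f u ≤ f (u + x / w u) / f u := by
    intro u x y hxy
    have h1 := (hw u).le
    exact div_le_div_of_nonneg_right (hf (by gcongr)) (hpos u).le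
  rw [tendsto_order]
  constructor
  · intro a ha
    have h1 := (h.and (hc.eventually (lt_mem_nhds ha))).filter_mono
      (nhdsWithin_le_nhds (s := Ioi t))
    obtain ⟨b, ⟨hb1, hb2⟩, hb3⟩ := (h1.and self_mem_nhdsWithin).exists
    have h2 := (hb1.eventually (lt_mem_nhds hb2)).prod_mk (gt_mem_nhds (show t < b from hb3))
    filter_upwards [h2] with p hp
    exact hp.1.trans_le (mono _ _ _ hp.2.le)
  · intro a ha
    have h1 := (h.and (hc.eventually (gt_mem_nhds ha))).filter_mono
      (nhdsWithin_le_nhds (s := Iio t))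
    obtain ⟨b, ⟨hb1, hb2⟩, hb3⟩ := (h1.and self_mem_nhdsWithin).exists
    have h2 := (hb1.eventually (gt_mem_nhds hb2)).prod_mk (lt_mem_nhds (show b < t from hb3))
    filter_upwards [h2] with p hp
    exact (mono _ _ _ hp.2.le).trans_lt hp.1

namespace IsGumbelTail_s2

variable {f w : ℝ → ℝ}

lemma tendsto_shift (h : IsGumbelTail_s2 f w) (x : ℝ) :
    Tendsto (fun u => u + x / w u) atTop atTop := by
  have h0 : Tendsto (fun u => f (u + x / w u)) atTop (𝓝 0) := by
    have := (h.tendsto_ratio x).mul h.tendsto_zero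
    rw [mul_zero] at this
    refine this.congr fun u => ?_
    have := (h.pos u).ne'
    field_simp
  rw [tendsto_atTop]
  intro B
  filter_upwards [h0.eventually (gt_mem_nhds (h.pos B))] with u hu
  exact (h.anti.reflect_lt hu).le

lemma tendsto_mul_scale (h : IsGumbelTail_s2 f w) : Tendsto (fun u => u * w u) atTop atTop := by
  rw [tendsto_atTop]
  intro B
  filter_upwards [(h.tendsto_shift (-B)).eventually_ge_atTop 0] with u hu
  have hw := h.scale_pos u
  rw [neg_div] at hu
  have : B / w u ≤ u := by linarith
  rwa [div_le_iff₀ hw] at this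

/-- Doubling the distance to `u`, at scale at least `M / w u`, divides the tail by `A`. -/
lemma exists_doubling (h : IsGumbelTail_s2 f w) {A : ℝ} (hA : 0 < A) :
    ∃ M > 0, ∀ᶠ u in atTop, ∀ t, M / w u ≤ t → A * f (u + 2 * t) ≤ f (u + t) := by
  set L := log (A + 1)
  set M := log (5 * (A + 1))
  have hL : exp (-L) = 1 / (A + 1) := by
    rw [exp_neg, exp_log (by linarith), one_div]
  have hL' : exp (- -L) = A + 1 := by rw [neg_neg, exp_log (by linarith)]
  have hM : exp (-M) = 1 / (5 * (A + 1)) := by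
    rw [exp_neg, exp_log (by linarith), one_div]
  have hM0 : 0 < M := log_pos (by linarith)
  have h1 := (h.tendsto_ratio L).eventually
    (gt_mem_nhds (show exp (-L) < 1 / A by rw [hL]; gcongr; linarith))
  have h2 := (h.tendsto_ratio (-L)).eventually
    (gt_mem_nhds (show exp (- -L) < 2 * (A + 1) by rw [hL']; linarith))
  have h3 := (h.tendsto_ratio M).eventually
    (gt_mem_nhds (show exp (-M) < 2 / (5 * (A + 1)) by rw [hM]; gcongr; linarith))
  obtain ⟨U, hU⟩ := eventually_atTop.1 (h1.and h2)
  refine ⟨M, hM0, ?_⟩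
  filter_upwards [h3, eventually_ge_atTop U] with u hu3 huU t ht
  have hwu := h.scale_pos u
  have ht0 : 0 < t := lt_of_lt_of_le (by positivity) ht
  obtain ⟨hv1, hv2⟩ := hU (u + t) (by linarith)
  have hwv := h.scale_pos (u + t)
  have hfv := h.pos (u + t)
  have hfu := h.pos u
  by_cases hc : L ≤ t * w (u + t)
  · have h4 : f (u + 2 * t) ≤ f (u + t + L / w (u + t)) := by
      apply h.anti
      have : L / w (u + t) ≤ t := by rwa [div_le_iff₀ hwv]
      linarith
    rw [div_lt_div_iff₀ hfv hA] at hv1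
    nlinarith
  · exfalso
    push Not at hc
    have h4 : t < L / w (u + t) := by rwa [lt_div_iff₀ hwv]
    have h5 : f u ≤ f (u + t + -L / w (u + t)) := by
      apply h.anti
      rw [neg_div]; linarith
    have h6 : f (u + t) ≤ f (u + M / w u) := h.anti (by linarith)
    rw [div_lt_iff₀ hfv] at hv2
    rw [div_lt_iff₀ hfu] at hu3
    have h7 : f u < 2 * (A + 1) * (2 / (5 * (A + 1)) * f u) := by
      calc f u < 2 * (A + 1) * f (u + t) := by linarith
        _ ≤ 2 * (A + 1) * f (u + M / w u) := by gcongr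
        _ ≤ _ := by gcongr
    have h8 : 2 * (A + 1) * (2 / (5 * (A + 1)) * f u) = 4 / 5 * f u := by
      field_simp; norm_num
    linarith

lemma tendsto_ratio_prod (h : IsGumbelTail_s2 f w) (t : ℝ) :
    Tendsto (fun p : ℝ × ℝ => f (p.1 + p.2 / w p.1) / f p.1) (atTop ×ˢ 𝓝 t)
      (𝓝 (exp (-t))) :=
  _root_.tendsto_ratio_prod h.anti h.pos h.scale_pos (Eventually.of_forall h.tendsto_ratio)

/-- Uniformly for `y` within `M / (u * w u)` of `1`, shifting `u` by `x / w u` multiplies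
`f (u * y)` by approximately `exp (-x)`. -/
lemma eventually_near (h : IsGumbelTail_s2 f w) (x M : ℝ) {ε : ℝ} (hε : 0 < ε) :
    ∀ᶠ u in atTop, ∀ y, 1 ≤ y → y ≤ 1 + M / (u * w u) →
      |f ((u + x / w u) * y) - exp (-x) * f (u * y)| ≤ ε * f (u * y) := by
  have key : ∀ t ∈ Icc (0 : ℝ) M, ∀ᶠ p : ℝ × ℝ in atTop ×ˢ 𝓝 t,
      |f (p.1 + (p.2 + x * (1 + p.2 / (p.1 * w p.1))) / w p.1) / f p.1
        / (f (p.1 + p.2 / w p.1) / f p.1) - exp (-x)| < ε := by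
    intro t _
    have hd : Tendsto (fun p : ℝ × ℝ => p.2 + x * (1 + p.2 / (p.1 * w p.1)))
        (atTop ×ˢ 𝓝 t) (𝓝 (t + x)) := by
      have h1 : Tendsto (fun p : ℝ × ℝ => p.2) (atTop ×ˢ 𝓝 t) (𝓝 t) := tendsto_snd
      have h2 := h1.div_atTop (h.tendsto_mul_scale.comp (tendsto_fst (f := atTop) (g := 𝓝 t)))
      have := h1.add ((h2.const_add 1).const_mul x)
      simpa using this
    have hn := (h.tendsto_ratio_prod (t + x)).comp (tendsto_fst.prodMk hd)
    have := hn.div (h.tendsto_ratio_prod t) (exp_pos _).ne'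
    rw [← exp_sub, show -(t + x) - -t = -x by ring] at this
    have := (this.sub_const (exp (-x))).abs
    rw [sub_self, abs_zero] at this
    exact this.eventually (gt_mem_nhds hε)
  have hall : ∀ᶠ u in atTop, ∀ t ∈ Icc (0 : ℝ) M,
      |f (u + (t + x * (1 + t / (u * w u))) / w u) / f u
        / (f (u + t / w u) / f u) - exp (-x)| < ε := by
    simp only [← eventually_iSup, ← isCompact_Icc.prod_nhdsSet_eq_biSup] at key
    exact key.curry.mono fun _ h => h.self_of_nhdsSet
  filter_upwards [hall, eventually_gt_atTop 0] with u hu hu0 y hy1 hy2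
  have hw := h.scale_pos u
  have hk := hu ((y - 1) * (u * w u)) ⟨by have : 0 ≤ y - 1 := by linarith
                                          positivity, by
    rw [← le_div_iff₀ (by positivity)]; linarith⟩
  have e1 : u + ((y - 1) * (u * w u) + x * (1 + (y - 1) * (u * w u) / (u * w u))) / w u
      = (u + x / w u) * y := by field_simp; ring
  have e2 : u + (y - 1) * (u * w u) / w u = u * y := by field_simp; ring
  rw [e1, e2, div_div_div_cancel_right₀ (h.pos u).ne'] at hk
  have hfy := h.pos (u * y)
  have : f ((u + x / w u) * y) - exp (-x) * f (u * y)
      = (f ((u + x / w u) * y) / f (u * y) - exp (-x)) * f (u * y) := by field_simp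
  rw [this, abs_mul, abs_of_pos hfy]
  gcongr

section Mixture

variable {ν : Measure ℝ} [IsFiniteMeasure ν]

lemma integrable_comp_mul (h : IsGumbelTail_s2 f w) (h1 : ∀ t, f t ≤ 1) (u : ℝ) :
    Integrable (fun y => f (u * y)) ν :=
  Integrable.of_bound (h.anti.measurable.comp (measurable_const_mul u)).aestronglyMeasurable 1
    (Eventually.of_forall fun y => by
      simpa [abs_of_pos (h.pos (u * y))] using h1 (u * y))

lemma integral_comp_mul_pos (h : IsGumbelTail_s2 f w) (h1 : ∀ t, f t ≤ 1) (hν0 : ν ≠ 0) (u : ℝ) :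
    0 < ∫ y, f (u * y) ∂ν := by
  rw [integral_pos_iff_support_of_nonneg (fun y => (h.pos _).le) (h.integrable_comp_mul h1 u)]
  have : Function.support (fun y => f (u * y)) = univ := by
    ext y; simpa using (h.pos (u * y)).ne'
  rw [this]
  exact Measure.measure_univ_pos.2 hν0

/-- If `ν` is doubling at `1`, the mixture `∫ f (u * y) dν` concentrates on `y` within
`O(1 / (u * w u))` of `1`. -/
lemma exists_far_le (h : IsGumbelTail_s2 f w) (h1 : ∀ t, f t ≤ 1)
    (hν : ∀ s > 0, ν.real (Iic (1 + 2 * s)) ≤ 2 * ν.real (Iic (1 + s)))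
    {ε : ℝ} (hε : 0 < ε) :
    ∃ M > 0, ∀ᶠ u in atTop,
      ∫ y in Ioi (1 + M / (u * w u)), f (u * y) ∂ν ≤ ε * ∫ y, f (u * y) ∂ν := by
  obtain ⟨M, hM, hd⟩ := h.exists_doubling (A := 4) (by norm_num)
  obtain ⟨J, hJ⟩ := exists_pow_lt_of_lt_one (show 0 < ε / 4 by linarith)
    (show (1 / 2 : ℝ) < 1 by norm_num)
  refine ⟨2 ^ J * M, by positivity, ?_⟩
  filter_upwards [hd, eventually_gt_atTop 0] with u hu hu0
  have hw := h.scale_pos u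
  set s := M / (u * w u) with hs
  have hs0 : 0 < s := by positivity
  have hus : u * s = M / w u := by rw [hs]; field_simp
  set C := f (u + M / w u) * ν.real (Iic (1 + s))
  have hC : C ≤ ∫ y, f (u * y) ∂ν := by
    calc C = ∫ y in Iic (1 + s), f (u + M / w u) ∂ν := by
          rw [setIntegral_const, smul_eq_mul, mul_comm]
      _ ≤ ∫ y in Iic (1 + s), f (u * y) ∂ν := by
          refine setIntegral_mono_on (integrable_const _).integrableOn
            (h.integrable_comp_mul h1 u).integrableOn measurableSet_Iic fun y hy => h.anti ?_
          rw [← hus]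
          have : u * y ≤ u * (1 + s) := by gcongr; exact hy
          linarith
      _ ≤ _ := setIntegral_le_integral (h.integrable_comp_mul h1 u)
          (Eventually.of_forall fun y => (h.pos _).le)
  have hC0 : 0 ≤ C := mul_nonneg (h.pos _).le measureReal_nonneg
  have hmass : ∀ k : ℕ, ν.real (Iic (1 + 2 ^ k * s)) ≤ 2 ^ k * ν.real (Iic (1 + s)) := by
    intro k
    induction k with
    | zero => simp
    | succ k ih =>
      have := hν (2 ^ k * s) (by positivity)
      rw [pow_succ, mul_comm ((2 : ℝ) ^ k) 2, mul_assoc, mul_assoc]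
      linarith
  have htail : ∀ k : ℕ, f (u + 2 ^ k * (M / w u)) ≤ (1 / 4) ^ k * f (u + M / w u) := by
    intro k
    induction k with
    | zero => simp
    | succ k ih =>
      have := hu (2 ^ k * (M / w u)) (le_mul_of_one_le_left (by positivity)
        (one_le_pow₀ (by norm_num)))
      rw [pow_succ, mul_comm ((2 : ℝ) ^ k) 2, mul_assoc, pow_succ]
      linarith
  set a : ℕ → ℝ := fun n => 1 + 2 ^ (J + n) * s
  have ha : Monotone a := fun m n hmn => by
    simp only [a]; gcongr; norm_num
  have hpiece : ∀ n : ℕ, ∫ y in a n..a (n + 1), f (u * y) ∂ν ≤ 2 * (1 / 2) ^ (J + n) * C := by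
    intro n
    rw [intervalIntegral.integral_of_le (ha n.le_succ)]
    calc ∫ y in Ioc (a n) (a (n + 1)), f (u * y) ∂ν
        ≤ ∫ y in Ioc (a n) (a (n + 1)), (1 / 4) ^ (J + n) * f (u + M / w u) ∂ν := by
          refine setIntegral_mono_on (h.integrable_comp_mul h1 u).integrableOn
            (integrable_const _).integrableOn measurableSet_Ioc fun y hy => ?_
          refine (h.anti ?_).trans (htail (J + n))
          have : u * (1 + 2 ^ (J + n) * s) ≤ u * y := by gcongr; exact hy.1.le
          rw [← hus]; linarith
      _ = (1 / 4) ^ (J + n) * f (u + M / w u) * ν.real (Ioc (a n) (a (n + 1))) := by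
          rw [setIntegral_const, smul_eq_mul, mul_comm]
      _ ≤ (1 / 4) ^ (J + n) * f (u + M / w u) * (2 ^ (J + n + 1) * ν.real (Iic (1 + s))) := by
          have := (h.pos (u + M / w u)).le
          gcongr
          exact (measureReal_mono Ioc_subset_Iic_self).trans (hmass (J + n + 1))
      _ = _ := by
          rw [show (1 / 4 : ℝ) = 1 / 2 * (1 / 2) by norm_num, mul_pow, pow_succ]
          have : (1 / 2 : ℝ) ^ (J + n) * 2 ^ (J + n) = 1 := by
            rw [← mul_pow]; norm_num
          linear_combination (2 * (1 / 2) ^ (J + n) * f (u + M / w u)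
            * ν.real (Iic (1 + s))) * this
  have hint : ∀ m n, IntervalIntegrable (fun y => f (u * y)) ν m n := fun m n =>
    (h.integrable_comp_mul h1 u).intervalIntegrable
  have hsum : ∀ n : ℕ, ∫ y in a 0..a n, f (u * y) ∂ν ≤ 4 * (1 / 2) ^ J * C * (1 - (1 / 2) ^ n) := by
    intro n
    induction n with
    | zero => simp
    | succ n ih =>
      rw [← intervalIntegral.integral_add_adjacent_intervals (hint _ (a n)) (hint _ _)]
      have := hpiece n
      rw [pow_add] at this
      rw [pow_succ]
      linarith
  have ha_top : Tendsto a atTop atTop := by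
    refine tendsto_atTop_add_const_left _ _ (Tendsto.atTop_mul_const hs0 ?_)
    have := tendsto_pow_atTop_atTop_of_one_lt (show (1 : ℝ) < 2 by norm_num)
    exact this.comp (tendsto_add_atTop_nat J |>.congr fun n => add_comm n J)
  have hlim := intervalIntegral_tendsto_integral_Ioi (a 0)
    (h.integrable_comp_mul h1 u (ν := ν)).integrableOn ha_top
  have hfin : ∫ y in Ioi (a 0), f (u * y) ∂ν ≤ 4 * (1 / 2) ^ J * C := by
    refine le_of_tendsto' hlim fun n => (hsum n).trans ?_
    refine mul_le_of_le_one_right (by positivity) ?_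
    have : (0 : ℝ) < (1 / 2) ^ n := by positivity
    linarith
  have ha0 : 1 + 2 ^ J * M / (u * w u) = a 0 := by simp only [a, hs, add_zero]; ring
  rw [ha0]
  calc _ ≤ 4 * (1 / 2) ^ J * C := hfin
    _ ≤ ε * C := by gcongr; linarith
    _ ≤ _ := by gcongr

/-- A scale mixture of a Gumbel tail over a finite measure on `[1, ∞)` that is doubling at `1`
inherits the Gumbel limit with the same scaling function. -/
lemma tendsto_mixture_ratio (h : IsGumbelTail_s2 f w) (h1 : ∀ t, f t ≤ 1) (hν0 : ν ≠ 0)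
    (hν1 : ∀ᵐ y ∂ν, 1 ≤ y)
    (hν : ∀ s > 0, ν.real (Iic (1 + 2 * s)) ≤ 2 * ν.real (Iic (1 + s)))
    {x : ℝ} (hx : 0 ≤ x) :
    Tendsto (fun u => (∫ y, f ((u + x / w u) * y) ∂ν) / ∫ y, f (u * y) ∂ν) atTop
      (𝓝 (exp (-x))) := by
  rw [Metric.tendsto_nhds]
  intro ε hε
  obtain ⟨M, hM, hfar⟩ := h.exists_far_le h1 hν (show 0 < ε / 3 by linarith)
  filter_upwards [hfar, h.eventually_near x M (show 0 < ε / 3 by linarith),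
    eventually_gt_atTop 0] with u hu1 hu2 hu0
  have hw := h.scale_pos u
  have hK := h.integral_comp_mul_pos h1 hν0 u
  set K := ∫ y, f (u * y) ∂ν
  set r := 1 + M / (u * w u)
  have hi1 := h.integrable_comp_mul h1 (u + x / w u) (ν := ν)
  have hi2 := h.integrable_comp_mul h1 u (ν := ν)
  have hi3 : Integrable (fun y => f ((u + x / w u) * y) - exp (-x) * f (u * y)) ν :=
    hi1.sub (hi2.const_mul _)
  have hle : exp (-x) ≤ 1 := by simpa using hx
  have hdiff : |(∫ y, f ((u + x / w u) * y) ∂ν) - exp (-x) * K| ≤ ε / 3 * K + ε / 3 * K := by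
    rw [← integral_const_mul, ← integral_sub hi1 (hi2.const_mul _)]
    calc _ ≤ ∫ y, |f ((u + x / w u) * y) - exp (-x) * f (u * y)| ∂ν :=
          abs_integral_le_integral_abs
      _ = (∫ y in Iic r, |f ((u + x / w u) * y) - exp (-x) * f (u * y)| ∂ν)
          + ∫ y in Ioi r, |f ((u + x / w u) * y) - exp (-x) * f (u * y)| ∂ν := by
          rw [← compl_Iic, integral_add_compl measurableSet_Iic hi3.abs]
      _ ≤ (∫ y in Iic r, ε / 3 * f (u * y) ∂ν) + ∫ y in Ioi r, f (u * y) ∂ν := by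
          gcongr ?_ + ?_
          · refine setIntegral_mono_on_ae hi3.abs.integrableOn (hi2.const_mul _).integrableOn
              measurableSet_Iic ?_
            filter_upwards [hν1] with y hy hyr
            exact hu2 y hy hyr
          · refine setIntegral_mono_on_ae hi3.abs.integrableOn hi2.integrableOn
              measurableSet_Ioi ?_
            filter_upwards [hν1] with y hy _
            have e1 : f ((u + x / w u) * y) ≤ f (u * y) := by
              apply h.anti
              gcongr
              have : 0 ≤ x / w u := by positivity
              linarith
            have e2 := h.pos ((u + x / w u) * y)
            have e3 := h.pos (u * y)
            have e4 : exp (-x) * f (u * y) ≤ f (u * y) := mul_le_of_le_one_left e3.le hle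
            have e5 : 0 < exp (-x) * f (u * y) := by positivity
            rw [abs_le]
            constructor <;> linarith
      _ ≤ _ := by
          gcongr
          rw [integral_const_mul]
          gcongr
          exact setIntegral_le_integral hi2 (Eventually.of_forall fun y => (h.pos _).le)
  rw [Real.dist_eq]
  have : (∫ y, f ((u + x / w u) * y) ∂ν) / K - exp (-x)
      = ((∫ y, f ((u + x / w u) * y) ∂ν) - exp (-x) * K) / K := by field_simp
  rw [this, abs_div, abs_of_pos hK, div_lt_iff₀ hK]
  have := mul_pos hε hK
  linarith

end Mixture

end IsGumbelTail_s2

/-- If `G` has the Gumbel limit and `G (q v) = C / v`, then the increments of `q` transfer to any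
other function `H` with the Gumbel limit, evaluated at `α * q v`. -/
lemma tendsto_ratio_at_quantile {G H w q : ℝ → ℝ} {α l C c : ℝ} (hα : 0 < α) (hC : 0 < C)
    (hG : Antitone G) (hGpos : ∀ t, 0 < G t) (hH : Antitone H) (hHpos : ∀ t, 0 < H t)
    (hw : ∀ u, 0 < w u)
    (hGlim : ∀ x : ℝ, 0 ≤ x → Tendsto (fun u => G (u + x / w u) / G u) atTop (𝓝 (exp (-x))))
    (hHlim : ∀ x : ℝ, 0 ≤ x → Tendsto (fun u => H (u + x / w u) / H u) atTop (𝓝 (exp (-x))))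
    (hl : 0 < l) (hwα : Tendsto (fun u => w (α * u) / w u) atTop (𝓝 l))
    (hq : Tendsto q atTop atTop) (hGq : ∀ᶠ v in atTop, G (q v) = C / v) (hc : 1 < c) :
    Tendsto (fun v => H (α * q (c * v)) / H (α * q v)) atTop (𝓝 (exp (-(α * l * log c)))) := by
  have hc0 : 0 < c := by linarith
  have hlog : 0 < log c := log_pos hc
  have hratio : ∀ᶠ v in atTop, G (q (c * v)) = exp (-log c) * G (q v) := by
    filter_upwards [hGq, (tendsto_id.const_mul_atTop hc0).eventually hGq,
      eventually_gt_atTop 0] with v h1 h2 hv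
    simp only [id] at h2
    rw [h1, h2, exp_neg, exp_log hc0]
    field_simp
  have hz : Tendsto (fun v => (q (c * v) - q v) * w (q v)) atTop (𝓝 (log c)) := by
    rw [tendsto_order]
    constructor
    · intro a ha
      have ha' : max a 0 < log c := max_lt ha hlog
      have := ((hGlim (max a 0) (le_max_right _ _)).comp hq).eventually
        (lt_mem_nhds (exp_lt_exp.2 (neg_lt_neg ha')))
      filter_upwards [this, hratio] with v h1 h2
      have hwv := hw (q v)
      simp only [Function.comp] at h1
      rw [lt_div_iff₀ (hGpos _), ← h2] at h1
      have := hG.reflect_lt h1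
      have h3 : max a 0 / w (q v) < q (c * v) - q v := by linarith
      rw [div_lt_iff₀ hwv] at h3
      exact (le_max_left _ _).trans_lt h3
    · intro b hb
      have := ((hGlim b (hlog.trans hb).le).comp hq).eventually
        (gt_mem_nhds (exp_lt_exp.2 (neg_lt_neg hb)))
      filter_upwards [this, hratio] with v h1 h2
      have hwv := hw (q v)
      simp only [Function.comp] at h1
      rw [div_lt_iff₀ (hGpos _), ← h2] at h1
      have := hG.reflect_lt h1
      have h3 : q (c * v) - q v < b / w (q v) := by linarith
      rwa [lt_div_iff₀ hwv] at h3
  have hz' : Tendsto (fun v => α * (w (α * q v) / w (q v)) * ((q (c * v) - q v) * w (q v)))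
      atTop (𝓝 (α * l * log c)) := ((hwα.comp hq).const_mul α).mul hz
  have hpos : 0 < α * l * log c := by positivity
  have hprod := tendsto_ratio_prod hH hHpos hw (t := α * l * log c)
    ((lt_mem_nhds hpos).mono fun x hx => hHlim x hx.le)
  refine (hprod.comp ((hq.const_mul_atTop hα).prodMk hz')).congr fun v => ?_
  have h1 := (hw (q v)).ne'
  have h2 := (hw (α * q v)).ne'
  simp only [Function.comp]
  congr 2
  field_simp
  ring

/-- The law of `cos κ / cos (|τ| + κ)` under Lebesgue measure on the arc where the denominator is
positive. -/
noncomputable def arcMeasure (κ : ℝ) : Measure ℝ :=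
  (volume.restrict (Ioo (-(π / 2 - κ)) (π / 2 - κ))).map fun τ => cos κ / cos (|τ| + κ)

lemma measurable_arc (κ : ℝ) : Measurable fun τ : ℝ => cos κ / cos (|τ| + κ) := by fun_prop

instance (κ : ℝ) : IsFiniteMeasure (arcMeasure κ) := by
  unfold arcMeasure; infer_instance

section Arc

variable {κ : ℝ}

lemma cos_arc_pos (h0 : 0 ≤ κ) {τ : ℝ} (hτ : τ ∈ Ioo (-(π / 2 - κ)) (π / 2 - κ)) :
    0 < cos (|τ| + κ) := by
  have := abs_lt.2 hτ
  have := abs_nonneg τ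
  exact cos_pos_of_mem_Ioo ⟨by linarith [pi_pos], by linarith⟩

lemma arcMeasure_ne_zero (h1 : κ < π / 2) : arcMeasure κ ≠ 0 := by
  unfold arcMeasure
  rw [Ne, Measure.map_eq_zero_iff (measurable_arc κ).aemeasurable, Measure.restrict_eq_zero,
    Real.volume_Ioo]
  simp only [ENNReal.ofReal_eq_zero, not_le]
  linarith

lemma ae_one_le_arcMeasure (h0 : 0 ≤ κ) : ∀ᵐ y ∂arcMeasure κ, 1 ≤ y := by
  unfold arcMeasure
  rw [ae_map_iff (measurable_arc κ).aemeasurable measurableSet_Ici]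
  filter_upwards [ae_restrict_mem measurableSet_Ioo] with τ hτ
  rw [one_le_div (cos_arc_pos h0 hτ)]
  have := abs_lt.2 hτ
  have := abs_nonneg τ
  exact cos_le_cos_of_nonneg_of_le_pi h0 (by linarith [pi_pos]) (by linarith)

lemma arcMeasure_doubling (h0 : 0 ≤ κ) {s : ℝ} (hs : 0 < s) :
    (arcMeasure κ).real (Iic (1 + 2 * s)) ≤ 2 * (arcMeasure κ).real (Iic (1 + s)) := by
  set A : ℝ → Set ℝ := fun s => (fun τ => cos κ / cos (|τ| + κ)) ⁻¹' Iic (1 + s) ∩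
    Ioo (-(π / 2 - κ)) (π / 2 - κ)
  have hA : ∀ s, (arcMeasure κ).real (Iic (1 + s)) = volume.real (A s) := fun s => by
    rw [arcMeasure, map_measureReal_apply (measurable_arc κ) measurableSet_Iic,
      measureReal_restrict_apply (measurable_arc κ measurableSet_Iic)]
  have hfin : ∀ s, volume (A s) ≠ ⊤ := fun s =>
    ((measure_mono inter_subset_right).trans_lt measure_Ioo_lt_top).ne
  have hsub : A (2 * s) ⊆ ((1 / 2 : ℝ) * ·) ⁻¹' A s := by
    rintro τ ⟨hτ1, hτ2⟩
    have hτ3 : 1 / 2 * τ ∈ Ioo (-(π / 2 - κ)) (π / 2 - κ) := by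
      obtain ⟨h1, h2⟩ := hτ2
      constructor <;> linarith
    refine ⟨?_, hτ3⟩
    have hp := cos_arc_pos h0 hτ2
    have hp' := cos_arc_pos h0 hτ3
    simp only [mem_preimage, mem_Iic] at hτ1 ⊢
    rw [div_le_iff₀ hp] at hτ1
    rw [div_le_iff₀ hp']
    have hm : cos κ + cos (|τ| + κ) ≤ 2 * cos (|1 / 2 * τ| + κ) := by
      have h2 := abs_lt.2 hτ2
      have h3 := abs_nonneg τ
      have := strictConcaveOn_cos_Icc.concaveOn.2 (x := κ) (y := |τ| + κ)
        ⟨by linarith [pi_pos], by linarith⟩ ⟨by linarith [pi_pos], by linarith⟩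
        (show (0 : ℝ) ≤ 1 / 2 by norm_num) (show (0 : ℝ) ≤ 1 / 2 by norm_num) (by norm_num)
      simp only [smul_eq_mul] at this
      rw [show 1 / 2 * κ + 1 / 2 * (|τ| + κ) = |1 / 2 * τ| + κ by
        rw [abs_mul, abs_of_pos (by norm_num : (0 : ℝ) < 1 / 2)]; ring] at this
      linarith
    have hκ : 0 ≤ cos κ := by
      have h2 := abs_lt.2 hτ2
      have h3 := abs_nonneg τ
      exact cos_nonneg_of_mem_Icc ⟨by linarith [pi_pos], by linarith⟩
    refine le_of_mul_le_mul_left ?_ (show 0 < 2 * (1 + 2 * s) by positivity)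
    have e1 := mul_le_mul_of_nonneg_left hm (show 0 ≤ (1 + 2 * s) * (1 + s) by positivity)
    have e2 := mul_le_mul_of_nonneg_left hτ1 (show 0 ≤ 1 + s by positivity)
    have e3 : 0 ≤ s ^ 2 * cos κ := by positivity
    linarith
  have hv : volume (((1 / 2 : ℝ) * ·) ⁻¹' A s) = 2 * volume (A s) := by
    rw [Real.volume_preimage_mul_left (by norm_num)]
    norm_num
  rw [hA, hA]
  have := (measure_mono hsub).trans_eq hv
  rw [measureReal_def, measureReal_def]
  have h3 := ENNReal.toReal_mono (ENNReal.mul_ne_top (by norm_num) (hfin s)) this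
  rwa [ENNReal.toReal_mul, ENNReal.toReal_ofNat] at h3

end Arc

lemma uniformCircle_eq_map_rotation (κ : ℝ) :
    uniformCircle = ((ENNReal.ofReal (2 * π))⁻¹ • volume.restrict (Ioc (-π) π)).map
      fun τ : ℝ => (cos (κ + τ), sin (κ + τ)) := by
  have hm : Measurable fun τ : ℝ => (cos τ, sin τ) := by fun_prop
  have hmκ : Measurable fun τ : ℝ => (cos (κ + τ), sin (κ + τ)) := by fun_prop
  rw [uniformCircle, Measure.map_smul, Measure.map_smul]
  congr 1
  ext S hS
  rw [Measure.map_apply hm hS, Measure.map_apply hmκ hS,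
    Measure.restrict_apply (hm hS), Measure.restrict_apply (hmκ hS)]
  have h1 := (isAddFundamentalDomain_Ioc two_pi_pos 0).measure_set_eq
    (isAddFundamentalDomain_Ioc two_pi_pos (κ - π)) (hm hS) (by
      rintro ⟨_, n, rfl⟩
      ext τ
      simp [AddSubgroup.vadd_def, add_comm _ τ, cos_add_int_mul_two_pi, sin_add_int_mul_two_pi])
  rw [zero_add] at h1
  rw [h1, ← measure_preimage_add volume κ]
  congr 1
  ext τ
  simp only [mem_preimage, mem_inter_iff, mem_Ioc, and_congr_right_iff]
  intro _
  constructor <;> rintro ⟨h2, h3⟩ <;> constructor <;> linarith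

section Polar

variable {Ω : Type*} [MeasurableSpace Ω] {μ : Measure Ω} [IsProbabilityMeasure μ] {R U₁ U₂ : Ω → ℝ}

lemma map_polar (hRmeas : Measurable R) (hUmeas : Measurable fun ω => (U₁ ω, U₂ ω))
    (hIndep : IndepFun R (fun ω => (U₁ ω, U₂ ω)) μ)
    (hUnif : μ.map (fun ω => (U₁ ω, U₂ ω)) = uniformCircle) :
    μ.map (fun ω => (R ω, U₁ ω, U₂ ω)) = (μ.map R).prod uniformCircle := by
  rw [(indepFun_iff_map_prod_eq_prod_map_map hRmeas.aemeasurable hUmeas.aemeasurable).1 hIndep,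
    hUnif]

lemma isProbabilityMeasure_uniformCircle_s2 (hUmeas : Measurable fun ω => (U₁ ω, U₂ ω))
    (hUnif : μ.map (fun ω => (U₁ ω, U₂ ω)) = uniformCircle) :
    IsProbabilityMeasure uniformCircle :=
  hUnif ▸ Measure.isProbabilityMeasure_map hUmeas.aemeasurable

lemma measure_polar (hRmeas : Measurable R) (hUmeas : Measurable fun ω => (U₁ ω, U₂ ω))
    (hIndep : IndepFun R (fun ω => (U₁ ω, U₂ ω)) μ)
    (hUnif : μ.map (fun ω => (U₁ ω, U₂ ω)) = uniformCircle)
    (κ : ℝ) {S : Set (ℝ × ℝ × ℝ)} (hS : MeasurableSet S) :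
    μ {ω | (R ω, U₁ ω, U₂ ω) ∈ S} = (ENNReal.ofReal (2 * π))⁻¹ *
      ∫⁻ τ in Ioc (-π) π, μ {ω | (R ω, cos (κ + τ), sin (κ + τ)) ∈ S} := by
  have := isProbabilityMeasure_uniformCircle_s2 hUmeas hUnif
  have := Measure.isProbabilityMeasure_map (μ := μ) hRmeas.aemeasurable
  have h1 : μ {ω | (R ω, U₁ ω, U₂ ω) ∈ S} = μ.map (fun ω => (R ω, U₁ ω, U₂ ω)) S := by
    rw [Measure.map_apply (hRmeas.prodMk hUmeas) hS]; rfl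
  rw [h1, map_polar hRmeas hUmeas hIndep hUnif, Measure.prod_apply_symm hS,
    uniformCircle_eq_map_rotation κ, lintegral_map (measurable_measure_prodMk_right hS) (by fun_prop),
    lintegral_smul_measure, smul_eq_mul]
  congr 2
  ext τ
  rw [Measure.map_apply hRmeas (measurable_prodMk_right hS)]
  rfl

lemma measure_radial_eq_zero (hRmeas : Measurable R) (hUmeas : Measurable fun ω => (U₁ ω, U₂ ω))
    (hIndep : IndepFun R (fun ω => (U₁ ω, U₂ ω)) μ)
    (hUnif : μ.map (fun ω => (U₁ ω, U₂ ω)) = uniformCircle)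
    (hR : ∀ᵐ ω ∂μ, 0 < R ω) (t : ℝ) :
    μ {ω | R ω * U₁ ω = t} = 0 := by
  have := isProbabilityMeasure_uniformCircle_s2 hUmeas hUnif
  have hS : MeasurableSet {p : ℝ × ℝ × ℝ | p.1 * p.2.1 = t} :=
    measurableSet_eq_fun (by fun_prop) measurable_const
  have h1 : μ {ω | R ω * U₁ ω = t} = μ.map (fun ω => (R ω, U₁ ω, U₂ ω))
      {p : ℝ × ℝ × ℝ | p.1 * p.2.1 = t} := by
    rw [Measure.map_apply (hRmeas.prodMk hUmeas) hS]; rfl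
  have hR' : ∀ᵐ r ∂μ.map R, 0 < r := by
    rwa [ae_map_iff hRmeas.aemeasurable measurableSet_Ioi]
  rw [h1, map_polar hRmeas hUmeas hIndep hUnif, Measure.measure_prod_null hS]
  filter_upwards [hR'] with r hr
  rw [uniformCircle, Measure.map_apply (by fun_prop) (measurable_prodMk_left hS), Measure.smul_apply,
    Pi.zero_apply, smul_eq_mul, mul_eq_zero]
  right
  refine nonpos_iff_eq_zero.1 ((Measure.restrict_apply_le _ _).trans
    (Set.Countable.measure_zero ?_ volume).le)
  have hsub : ∀ a ∈ {a : ℝ | cos a = t / r}, {a : ℝ | cos a = t / r} ⊆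
      range (fun k : ℤ => 2 * k * π + a) ∪ range (fun k : ℤ => 2 * k * π - a) := by
    intro a ha b hb
    obtain ⟨k, hk | hk⟩ := cos_eq_cos_iff.1 (Eq.trans ha (Eq.symm hb))
    · exact Or.inl ⟨k, hk.symm⟩
    · exact Or.inr ⟨k, hk.symm⟩
  have hcount : {a : ℝ | cos a = t / r}.Countable := by
    rcases eq_empty_or_nonempty {a : ℝ | cos a = t / r} with h | ⟨a, ha⟩
    · rw [h]; exact countable_empty
    · exact ((countable_range _).union (countable_range _)).mono (hsub a ha)
  refine hcount.mono fun a ha => ?_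
  simp only [mem_preimage, mem_ofPred_eq] at ha ⊢
  rw [eq_div_iff hr.ne', mul_comm, ha]

lemma measure_radial_eq_mixture (hRmeas : Measurable R)
    (hUmeas : Measurable fun ω => (U₁ ω, U₂ ω))
    (hIndep : IndepFun R (fun ω => (U₁ ω, U₂ ω)) μ)
    (hUnif : μ.map (fun ω => (U₁ ω, U₂ ω)) = uniformCircle)
    (hR : ∀ᵐ ω ∂μ, 0 < R ω) {κ : ℝ} (h0 : 0 ≤ κ) (h1 : κ < π / 2) {x : ℝ} (hx : 0 < x)
    {S : Set (ℝ × ℝ × ℝ)} (hS : MeasurableSet S)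
    (hSx : ∀ r > 0, ∀ τ ∈ Ioc (-π) π,
      ((r, cos (κ + τ), sin (κ + τ)) ∈ S ↔ x < r * cos (|τ| + κ))) :
    μ.real {ω | (R ω, U₁ ω, U₂ ω) ∈ S} =
      (2 * π)⁻¹ * ∫ y, μ.real {ω | x / cos κ * y < R ω} ∂arcMeasure κ := by
  have hanti : Antitone fun t => μ.real {ω | t < R ω} := fun a b hab =>
    measureReal_mono fun ω (hω : b < R ω) => hab.trans_lt hω
  have hcos : 0 < cos κ := cos_pos_of_mem_Ioo ⟨by linarith [pi_pos], h1⟩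
  have hint : ∀ τ ∈ Ioc (-π) π, μ {ω | (R ω, cos (κ + τ), sin (κ + τ)) ∈ S} =
      (Ioo (-(π / 2 - κ)) (π / 2 - κ)).indicator
        (fun τ => ENNReal.ofReal (μ.real {ω | x / cos κ * (cos κ / cos (|τ| + κ)) < R ω})) τ := by
    intro τ hτ
    by_cases hτ' : τ ∈ Ioo (-(π / 2 - κ)) (π / 2 - κ)
    · rw [indicator_of_mem hτ', ofReal_measureReal]
      refine measure_congr ?_
      filter_upwards [hR] with ω hω
      refine propext ((hSx _ hω τ hτ).trans ?_)
      have hp := cos_arc_pos h0 hτ'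
      change _ ↔ x / cos κ * (cos κ / cos (|τ| + κ)) < R ω
      rw [div_mul_div_cancel₀ hcos.ne', div_lt_iff₀ hp]
    · rw [indicator_of_notMem hτ', measure_eq_zero_iff_ae_notMem]
      filter_upwards [hR] with ω hω hmem
      have h2 := (hSx _ hω τ hτ).1 hmem
      have h3 : π / 2 - κ ≤ |τ| := by
        by_contra hlt
        exact hτ' (abs_lt.1 (not_le.1 hlt))
      have h4 : |τ| ≤ π := abs_le.2 ⟨hτ.1.le, hτ.2⟩
      have h5 : cos (|τ| + κ) ≤ 0 :=
        cos_nonpos_of_pi_div_two_le_of_le (by linarith) (by linarith)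
      have := mul_nonpos_of_nonneg_of_nonpos hω.le h5
      linarith
  have hsub : Ioo (-(π / 2 - κ)) (π / 2 - κ) ⊆ Ioc (-π) π := fun τ hτ =>
    ⟨by linarith [hτ.1, pi_pos], by linarith [hτ.2, pi_pos]⟩
  have hmeas : Measurable fun y => μ.real {ω | x / cos κ * y < R ω} :=
    hanti.measurable.comp (measurable_const_mul _)
  rw [measureReal_def, measure_polar hRmeas hUmeas hIndep hUnif κ hS,
    setLIntegral_congr_fun measurableSet_Ioc hint, setLIntegral_indicator measurableSet_Ioo,
    inter_eq_left.2 hsub, ENNReal.toReal_mul, ENNReal.toReal_inv,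
    ENNReal.toReal_ofReal two_pi_pos.le, arcMeasure,
    integral_map (measurable_arc κ).aemeasurable hmeas.aestronglyMeasurable,
    integral_eq_lintegral_of_nonneg_ae (Eventually.of_forall fun _ => measureReal_nonneg)
      (hmeas.comp (measurable_arc κ)).aestronglyMeasurable]

end Polar

/-- If the distribution function of `X` is continuous, its strict superlevel sets are right
half-lines starting at a quantile. -/
lemma exists_superlevel_eq_Ioi {Q : ℝ → ℝ} (hmono : Monotone Q) (hcont : Continuous Q)
    (hbot : Tendsto Q atBot (𝓝 0)) (htop : Tendsto Q atTop (𝓝 1)) {p : ℝ} (h0 : 0 < p)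
    (h1 : p < 1) : ∃ q, Q q = p ∧ ∀ t, p < Q t ↔ q < t := by
  obtain ⟨a, ha⟩ := (hbot.eventually (gt_mem_nhds h0)).exists
  obtain ⟨b, hb⟩ := (htop.eventually (lt_mem_nhds h1)).exists
  have hbdd : BddAbove {t | Q t ≤ p} := ⟨b, fun t ht => (hmono.reflect_lt (ht.trans_lt hb)).le⟩
  have hmem : Q (sSup {t | Q t ≤ p}) ≤ p :=
    (isClosed_le hcont continuous_const).csSup_mem ⟨a, ha.le⟩ hbdd
  have hiff : ∀ t, p < Q t ↔ sSup {t | Q t ≤ p} < t := by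
    intro t
    constructor
    · intro ht
      exact hmono.reflect_lt (hmem.trans_lt ht)
    · intro ht
      by_contra hle
      exact (le_csSup hbdd (not_lt.1 hle)).not_gt ht
  refine ⟨_, le_antisymm hmem ?_, hiff⟩
  refine ge_of_tendsto (hcont.continuousWithinAt (s := Ioi (sSup {t | Q t ≤ p}))) ?_
  filter_upwards [self_mem_nhdsWithin] with t ht
  exact ((hiff t).2 ht).le

lemma continuous_cdf_of_measure_eq_zero (P : Measure ℝ) [IsProbabilityMeasure P]
    (h : ∀ t, P {t} = 0) : Continuous (cdf P) := by
  rw [continuous_iff_continuousAt]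
  intro t
  rw [(monotone_cdf P).continuousAt_iff_leftLim_eq_rightLim, StieltjesFunction.rightLim_eq]
  have h1 := (cdf P).measure_singleton t
  rw [measure_cdf, h t, eq_comm, ENNReal.ofReal_eq_zero] at h1
  exact le_antisymm ((monotone_cdf P).leftLim_le le_rfl) (by linarith)

/-- Convergence of `s (c * u) / s u` for `c > 1` extends to all `c > 0`. -/
lemma tendsto_ratio_of_one_lt {s : ℝ → ℝ} {e : ℝ} (hs : ∀ᶠ u in atTop, s u ≠ 0)
    (h : ∀ c : ℝ, 1 < c → Tendsto (fun u => s (c * u) / s u) atTop (𝓝 (c ^ e))) {c : ℝ}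
    (hc : 0 < c) : Tendsto (fun u => s (c * u) / s u) atTop (𝓝 (c ^ e)) := by
  rcases lt_trichotomy c 1 with hc1 | rfl | hc1
  · have h1 := ((h c⁻¹ ((one_lt_inv₀ hc).2 hc1)).comp
      (tendsto_id.const_mul_atTop hc)).inv₀ (rpow_pos_of_pos (inv_pos.2 hc) e).ne'
    rw [inv_rpow hc.le, inv_inv] at h1
    refine h1.congr fun u => ?_
    simp only [Function.comp, id, inv_div]
    rw [inv_mul_cancel_left₀ hc.ne']
  · rw [one_rpow]
    refine tendsto_const_nhds.congr' ?_
    filter_upwards [hs] with u hu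
    rw [one_mul, div_self hu]
  · exact h c hc1

end GumbelTail

/-- If `F` is in the Gumbel max-domain of attraction with scaling function `w` satisfying
`w(cu)/w(u) → c^(θ-1)` for all `c > 0` (some `θ ∈ [0,∞)`), then `u ↦ S̃_u(1,1)` is
regularly varying at infinity with index `-1/η`, where `η = ((1+ρ)/2)^(θ/2)`. -/
theorem Stilde_regularly_varying
    {Ω : Type*} [MeasurableSpace Ω] (μ : Measure Ω) [IsProbabilityMeasure μ]
    (R U₁ U₂ : Ω → ℝ) (ρ : ℝ) (hρ : ρ ∈ Set.Ioo (-1 : ℝ) 1)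
    (hRmeas : Measurable R) (hUmeas : Measurable fun ω => (U₁ ω, U₂ ω))
    (hIndep : IndepFun R (fun ω => (U₁ ω, U₂ ω)) μ)
    (hUnif : Measure.map (fun ω => (U₁ ω, U₂ ω)) μ = uniformCircle)
    (X₁ X₂ : Ω → ℝ)
    (hX₁ : X₁ = fun ω => R ω * U₁ ω)
    (hX₂ : X₂ = fun ω => R ω * (ρ * U₁ ω + Real.sqrt (1 - ρ ^ 2) * U₂ ω))
    -- `F` is the distribution function of the positive random radius `R`
    (F : ℝ → ℝ) (hF : F = fun t => (μ {ω | R ω ≤ t}).toReal)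
    (hF0 : F 0 = 0) (hFlt : ∀ x > (0 : ℝ), F x < 1)
    -- `Q` is the distribution function of `X₁`
    (Q : ℝ → ℝ) (hQ : Q = fun t => (μ {ω | X₁ ω ≤ t}).toReal)
    -- `F` is in the Gumbel max-domain of attraction with positive scaling function `w`
    (w : ℝ → ℝ) (hw : ∀ u, 0 < w u)
    (hGumbel : ∀ x : ℝ,
      Tendsto (fun u => (1 - F (u + x / w u)) / (1 - F u)) atTop (nhds (Real.exp (-x))))
    -- the joint survival function `S̃_u(x,y)`
    (Stilde : ℝ → ℝ → ℝ → ℝ)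
    (hStilde : ∀ u x y,
      Stilde u x y = (μ {ω | 1 - x / u < Q (X₁ ω) ∧ 1 - y / u < Q (X₂ ω)}).toReal)
    (αρ : ℝ) (hαρ : αρ = Real.sqrt (2 / (1 + ρ)))
    -- condition (2.7): `w` is regularly varying with index `θ - 1`, `θ ∈ [0,∞)`
    (θ : ℝ) (hθ : 0 ≤ θ)
    (hwrv : ∀ c > (0 : ℝ), Tendsto (fun u => w (c * u) / w u) atTop (nhds (c ^ (θ - 1))))
    (η : ℝ) (hη : η = ((1 + ρ) / 2) ^ (θ / 2)) :
    ∀ c > (0 : ℝ),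
      Tendsto (fun u => Stilde (c * u) 1 1 / Stilde u 1 1) atTop
        (nhds (c ^ (-1 / η))) := by
  have hπ := pi_pos
  have h2π : 0 < 2 * π := by positivity
  set κ := arccos ρ / 2 with hκ
  have hκ0 : 0 ≤ κ := div_nonneg (arccos_nonneg ρ) zero_le_two
  have hκ1 : κ < π / 2 := by
    have : arccos ρ < π := lt_of_le_of_ne (arccos_le_pi ρ) fun h => by
      rw [arccos_eq_pi] at h; exact absurd hρ.1 (not_lt.2 h)
    linarith
  have hcosκ : 0 < cos κ := cos_pos_of_mem_Ioo ⟨by linarith, hκ1⟩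
  have hcos2κ : cos (2 * κ) = ρ := by
    rw [hκ, mul_div_cancel₀ _ two_ne_zero, cos_arccos hρ.1.le hρ.2.le]
  have hsin2κ : sin (2 * κ) = √(1 - ρ ^ 2) := by
    rw [hκ, mul_div_cancel₀ _ two_ne_zero, sin_arccos]
  -- the tail of the radius
  set f : ℝ → ℝ := fun t => μ.real {ω | t < R ω} with hf
  have hFf : ∀ t, 1 - F t = f t := fun t => by
    have h1 : {ω | t < R ω} = {ω | R ω ≤ t}ᶜ := by ext; simp
    rw [hf, hF]
    simp only
    rw [h1, probReal_compl_eq_one_sub (measurableSet_le hRmeas measurable_const), measureReal_def]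
  have hR : ∀ᵐ ω ∂μ, 0 < R ω := by
    have h1 : μ {ω | R ω ≤ 0} = 0 := by
      have h2 : (μ {ω | R ω ≤ 0}).toReal = 0 := by simpa [hF] using hF0
      exact (measureReal_eq_zero_iff).1 h2
    rw [measure_eq_zero_iff_ae_notMem] at h1
    filter_upwards [h1] with ω hω
    exact not_le.1 hω
  have hanti : Antitone f := fun a b hab =>
    measureReal_mono fun ω (hω : b < R ω) => hab.trans_lt hω
  have hf1 : ∀ t, f t ≤ 1 := fun t => measureReal_le_one
  have hfpos : ∀ t, 0 < f t := fun t => by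
    have h1 : 0 < f (max t 1) := by
      rw [← hFf, sub_pos]
      exact hFlt _ (lt_max_of_lt_right one_pos)
    exact h1.trans_le (hanti (le_max_left _ _))
  have hf0 : Tendsto f atTop (nhds 0) := by
    have := Measure.isProbabilityMeasure_map (μ := μ) hRmeas.aemeasurable
    have h1 := (tendsto_cdf_atTop (μ.map R)).const_sub 1
    rw [sub_self] at h1
    refine h1.congr fun t => ?_
    rw [← hFf, cdf_eq_real, map_measureReal_apply hRmeas measurableSet_Iic, hF]
    rfl
  have hT : IsGumbelTail_s2 f w := ⟨hanti, hfpos, hf0, hw, fun x => by simpa only [hFf] using hGumbel x⟩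
  -- the marginal and joint tails as mixtures
  set K : ℝ → ℝ → ℝ := fun k x => ∫ y, f (x * y) ∂arcMeasure k with hK
  have hKpos : ∀ k, k < π / 2 → ∀ x, 0 < K k x := fun k hk x =>
    hT.integral_comp_mul_pos hf1 (arcMeasure_ne_zero hk) x
  have hKanti : ∀ k, 0 ≤ k → Antitone (K k) := fun k hk a b hab => by
    refine integral_mono_ae (hT.integrable_comp_mul hf1 b) (hT.integrable_comp_mul hf1 a) ?_
    filter_upwards [ae_one_le_arcMeasure hk] with y hy
    exact hanti (mul_le_mul_of_nonneg_right hab (zero_le_one.trans hy))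
  have hKlim : ∀ k, 0 ≤ k → k < π / 2 → ∀ x : ℝ, 0 ≤ x →
      Tendsto (fun u => K k (u + x / w u) / K k u) atTop (nhds (exp (-x))) := fun k hk hk' x hx =>
    hT.tendsto_mixture_ratio hf1 (arcMeasure_ne_zero hk') (ae_one_le_arcMeasure hk)
      (fun s hs => arcMeasure_doubling hk hs) hx
  have hG : ∀ x, 0 < x → μ.real {ω | x < X₁ ω} = (2 * π)⁻¹ * K 0 x := fun x hx => by
    have h1 := measure_radial_eq_mixture hRmeas hUmeas hIndep hUnif hR le_rfl (by positivity) hx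
      (S := {p | x < p.1 * p.2.1}) (measurableSet_lt measurable_const (by fun_prop))
      (fun r _ τ _ => by simp)
    rw [cos_zero, div_one] at h1
    rw [hX₁]
    exact h1
  have hH : ∀ x, 0 < x → μ.real {ω | x < X₁ ω ∧ x < X₂ ω} = (2 * π)⁻¹ * K κ ((cos κ)⁻¹ * x) := by
    intro x hx
    have h1 := measure_radial_eq_mixture hRmeas hUmeas hIndep hUnif hR hκ0 hκ1 hx
      (S := {p | x < p.1 * p.2.1} ∩ {p | x < p.1 * (ρ * p.2.1 + √(1 - ρ ^ 2) * p.2.2)})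
      (.inter (measurableSet_lt measurable_const (by fun_prop))
        (measurableSet_lt measurable_const (by fun_prop)))
      (fun r hr τ hτ => by
        have h2 : ρ * cos (κ + τ) + √(1 - ρ ^ 2) * sin (κ + τ) = cos (κ - τ) := by
          rw [← hsin2κ, ← hcos2κ, ← cos_sub]; congr 1; ring
        have h3 : cos (κ + |τ|) = min (cos (κ + τ)) (cos (κ - τ)) := by
          have hs : 0 ≤ sin κ := sin_nonneg_of_nonneg_of_le_pi hκ0 (by linarith)
          rcases le_total 0 τ with h | h
          · have hs' := mul_nonneg hs (sin_nonneg_of_nonneg_of_le_pi h hτ.2)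
            rw [abs_of_nonneg h, min_eq_left]
            rw [cos_add, cos_sub]; linarith
          · have hs' := mul_nonneg hs (sin_nonneg_of_nonneg_of_le_pi (neg_nonneg.2 h)
              (by linarith [hτ.1]))
            rw [sin_neg] at hs'
            rw [abs_of_nonpos h, ← sub_eq_add_neg, min_eq_right]
            rw [cos_add, cos_sub]; linarith
        change x < r * cos (κ + τ) ∧ x < r * (ρ * cos (κ + τ) + √(1 - ρ ^ 2) * sin (κ + τ)) ↔ _
        rw [h2, add_comm |τ|, h3, ← div_lt_iff₀' hr, ← div_lt_iff₀' hr, ← div_lt_iff₀' hr, lt_min_iff])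
    rw [hX₁, hX₂, inv_mul_eq_div (cos κ)]
    exact h1
  -- quantiles of the marginal
  have hX₁meas : Measurable X₁ := by
    rw [hX₁]; exact hRmeas.mul (measurable_fst.comp hUmeas)
  have hXprob := Measure.isProbabilityMeasure_map (μ := μ) hX₁meas.aemeasurable
  have hQcdf : Q = cdf (μ.map X₁) := by
    ext t
    rw [cdf_eq_real, map_measureReal_apply hX₁meas measurableSet_Iic, hQ]
    rfl
  have hQcont : Continuous Q := by
    rw [hQcdf]
    refine continuous_cdf_of_measure_eq_zero _ fun t => ?_
    rw [Measure.map_apply hX₁meas (measurableSet_singleton t), hX₁]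
    exact measure_radial_eq_zero hRmeas hUmeas hIndep hUnif hR t
  have hQG : ∀ t, 1 - Q t = μ.real {ω | t < X₁ ω} := fun t => by
    have h1 : {ω | t < X₁ ω} = {ω | X₁ ω ≤ t}ᶜ := by ext; simp
    rw [h1, probReal_compl_eq_one_sub (measurableSet_le hX₁meas measurable_const), hQ,
      measureReal_def]
  have hQlt : ∀ t, Q t < 1 := fun t => by
    have h1 : 0 < 1 - Q (max t 1) := by
      rw [hQG, hG _ (lt_max_of_lt_right one_pos)]
      exact mul_pos (inv_pos.2 h2π) (hKpos 0 (by positivity) _)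
    have h2 : Q t ≤ Q (max t 1) := by
      rw [hQcdf]; exact monotone_cdf _ (le_max_left _ _)
    linarith
  have hex : ∀ v : ℝ, 1 < v → ∃ q, Q q = 1 - 1 / v ∧ ∀ t, 1 - 1 / v < Q t ↔ q < t := by
    intro v hv
    have h1 : 1 / v < 1 := by rw [div_lt_one (by linarith)]; exact hv
    have h2 : 0 < 1 / v := by positivity
    refine exists_superlevel_eq_Ioi ?_ hQcont ?_ ?_ (by linarith) (by linarith) <;> rw [hQcdf]
    · exact monotone_cdf _
    · exact tendsto_cdf_atBot _
    · exact tendsto_cdf_atTop _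
  choose! q hq hqiff using hex
  have hqtop : Tendsto q atTop atTop := by
    rw [tendsto_atTop]
    intro B
    have h1 : Tendsto (fun v : ℝ => 1 - 1 / v) atTop (nhds 1) := by
      simpa using (tendsto_inv_atTop_zero (𝕜 := ℝ)).const_sub 1
    filter_upwards [h1.eventually (lt_mem_nhds (hQlt B)), eventually_gt_atTop 1] with v h2 h3
    by_contra hlt
    exact ((hqiff v h3 B).2 (not_le.1 hlt)).not_gt h2
  have hGq : ∀ᶠ v in atTop, K 0 (q v) = 2 * π / v := by
    filter_upwards [hqtop.eventually_gt_atTop 0, eventually_gt_atTop 1] with v h1 h2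
    have h3 := hQG (q v)
    rw [hG _ h1, hq v h2, sub_sub_cancel, ← div_eq_inv_mul, eq_div_iff h2π.ne'] at h3
    rw [← h3]; ring
  have hS : ∀ᶠ v in atTop, Stilde v 1 1 = (2 * π)⁻¹ * K κ ((cos κ)⁻¹ * q v) := by
    filter_upwards [hqtop.eventually_gt_atTop 0, eventually_gt_atTop 1] with v h1 h2
    rw [hStilde, ← hH _ h1, measureReal_def]
    simp only [hqiff v h2]
  have hη' : -1 / η = -((cos κ)⁻¹ * (cos κ)⁻¹ ^ (θ - 1)) := by
    have h1 : (1 + ρ) / 2 = cos κ ^ (2 : ℝ) := by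
      rw [rpow_two, ← hcos2κ, cos_two_mul]; ring
    have h2 : (cos κ)⁻¹ * (cos κ)⁻¹ ^ (θ - 1) = (cos κ)⁻¹ ^ θ := by
      rw [rpow_sub_one (inv_pos.2 hcosκ).ne', mul_div_cancel₀ _ (inv_pos.2 hcosκ).ne']
    rw [h2, hη, h1, ← rpow_mul hcosκ.le, mul_div_cancel₀ _ two_ne_zero, inv_rpow hcosκ.le,
      neg_div, one_div]
  intro c hc
  refine tendsto_ratio_of_one_lt (s := fun u => Stilde u 1 1) ?_ ?_ hc
  · filter_upwards [hS] with v hv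
    rw [hv]
    exact (mul_pos (inv_pos.2 h2π) (hKpos κ hκ1 _)).ne'
  · intro c hc
    have hc0 : 0 < c := one_pos.trans hc
    have h1 := tendsto_ratio_at_quantile (inv_pos.2 hcosκ) h2π (hKanti 0 le_rfl)
      (hKpos 0 (by positivity)) (hKanti κ hκ0) (hKpos κ hκ1) hw (hKlim 0 le_rfl (by positivity))
      (hKlim κ hκ0 hκ1) (rpow_pos_of_pos (inv_pos.2 hcosκ) (θ - 1))
      (hwrv _ (inv_pos.2 hcosκ)) hqtop hGq hc
    rw [rpow_def_of_pos hc0, hη', mul_neg, mul_comm (log c)]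
    refine h1.congr' ?_
    filter_upwards [hS, (tendsto_id.const_mul_atTop hc0).eventually hS] with v h2 h3
    simp only [id] at h3
    rw [h2, h3, mul_div_mul_left _ _ (inv_pos.2 h2π).ne']
end
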